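/- arXiv:2309.05011 — 3 statements merged into one kernel-verified Lean document; each statement's English description precedes it below -/
import Mathlib

section
/- Let k be a field, d ≥ 5 an integer, S = k[x_1,…,x_d,y_1,…,y_d], and fix an integer a with 2 ≤ a ≤ d − 1. Let I(G_{d,a}) = x_1(y_1,…,y_d) + (x_i y_j : 2 ≤ i ≤ j ≤ a) + (x_i y_j : a+1 ≤ i ≤ j ≤ d). Then the colon ideal I(G_{d,a})^3 : (x_1 y_a x_1 y_d) = I(K_{d,d}), where I(K_{d,d}) = (x_i y_j : 1 ≤ i, j ≤ d) is the edge ideal of the complete bipartite graph on {x_1,…,x_d} ∪ {y_1,…,y_d}. -/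
open MvPolynomial

/-- The maximal homogeneous ideal of the polynomial ring, generated by all variables. -/
noncomputable def maxHomIdeal (k : Type) [Field k] (V : Type) : Ideal (MvPolynomial V k) :=
  Ideal.span (Set.range (X : V → MvPolynomial V k))

/-- `depthQuot k I` is the depth of `S/I` where `S = k[x_v : v ∈ V]`, defined as
`min {i : H^i_m(S/I) ≠ 0}` where `m` is the maximal homogeneous ideal and `H^i_m` is
local cohomology. -/
noncomputable def depthQuot (k : Type) [Field k] {V : Type} (I : Ideal (MvPolynomial V k)) : ℕ :=
  sInf {i : ℕ |
    Nontrivial ((localCohomology (maxHomIdeal k V) i).obj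
      (ModuleCat.of (MvPolynomial V k) (MvPolynomial V k ⧸ I)))}

/-- The edge ideal of a simple graph `G`, generated by the monomials `x_i x_j` for
edges `{i, j}` of `G`. -/
noncomputable def edgeIdeal (k : Type) [Field k] {V : Type} (G : SimpleGraph V) :
    Ideal (MvPolynomial V k) :=
  Ideal.span {p | ∃ i j, G.Adj i j ∧ p = X i * X j}

/-- The ideal generated by the monomials of degree at least `n` in each of the two groups of
variables. -/
noncomputable def bidegreeIdeal (k : Type) [Field k] (d n : ℕ) :
    Ideal (MvPolynomial (Fin d ⊕ Fin d) k) :=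
  Ideal.span ((fun s : (Fin d ⊕ Fin d) →₀ ℕ => monomial s (1 : k)) ''
    {s | n ≤ ∑ i, s (Sum.inl i) ∧ n ≤ ∑ i, s (Sum.inr i)})

theorem bidegreeIdeal_mul_le (k : Type) [Field k] (d m n : ℕ) :
    bidegreeIdeal k d m * bidegreeIdeal k d n ≤ bidegreeIdeal k d (m + n) := by
  unfold bidegreeIdeal
  rw [Ideal.span_mul_span', Ideal.span_le]
  rintro _ ⟨_, ⟨s, ⟨hs, hs'⟩, rfl⟩, _, ⟨t, ⟨ht, ht'⟩, rfl⟩, rfl⟩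
  refine Ideal.subset_span ⟨s + t, ⟨?_, ?_⟩, ?_⟩
  · simp only [Finsupp.add_apply, Finset.sum_add_distrib]
    omega
  · simp only [Finsupp.add_apply, Finset.sum_add_distrib]
    omega
  · simp [monomial_mul]

theorem X_mul_X_eq_monomial {k σ : Type} [Field k] (u v : σ) :
    (X u * X v : MvPolynomial σ k) =
      monomial (Finsupp.single u 1 + Finsupp.single v 1) 1 := by
  simp [X, monomial_mul]

theorem X_mul_X_mem_bidegreeIdeal (k : Type) [Field k] {d : ℕ} (i j : Fin d) :
    X (Sum.inl i) * X (Sum.inr j) ∈ bidegreeIdeal k d 1 := by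
  refine Ideal.subset_span ⟨_, ⟨?_, ?_⟩, (X_mul_X_eq_monomial _ _).symm⟩ <;>
  simp [Finsupp.single_apply]

theorem bidegreeIdeal_one_le (k : Type) [Field k] (d : ℕ) :
    bidegreeIdeal k d 1 ≤ Ideal.span {p : MvPolynomial (Fin d ⊕ Fin d) k |
      ∃ i j : Fin d, p = X (Sum.inl i) * X (Sum.inr j)} := by
  refine Ideal.span_le.2 ?_
  rintro _ ⟨s, ⟨hx, hy⟩, rfl⟩
  obtain ⟨i, -, hi⟩ := Finset.exists_ne_zero_of_sum_ne_zero (Nat.one_le_iff_ne_zero.1 hx)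
  obtain ⟨j, -, hj⟩ := Finset.exists_ne_zero_of_sum_ne_zero (Nat.one_le_iff_ne_zero.1 hy)
  refine Ideal.mem_of_dvd _ ?_ (Ideal.subset_span ⟨i, j, rfl⟩)
  rw [X_mul_X_eq_monomial, monomial_dvd_monomial]
  refine ⟨Or.inr fun v => ?_, dvd_rfl⟩
  rcases v with v | v <;> simp only [Finsupp.add_apply, Finsupp.single_apply, Sum.inl.injEq,
    Sum.inr.injEq, reduceCtorEq, if_false] <;> split_ifs with h <;> (try subst h) <;> omega

theorem mem_bidegreeIdeal_iff {k : Type} [Field k] {d n : ℕ}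
    {f : MvPolynomial (Fin d ⊕ Fin d) k} :
    f ∈ bidegreeIdeal k d n ↔
      ∀ u ∈ f.support, n ≤ ∑ i, u (Sum.inl i) ∧ n ≤ ∑ i, u (Sum.inr i) := by
  unfold bidegreeIdeal
  rw [mem_ideal_span_monomial_image]
  refine forall₂_congr fun u _ => ⟨?_, fun h => ⟨u, h, le_rfl⟩⟩
  rintro ⟨s, ⟨hx, hy⟩, hs⟩
  exact ⟨hx.trans (Finset.sum_le_sum fun i _ => hs _), hy.trans (Finset.sum_le_sum fun i _ => hs _)⟩

theorem mem_bidegreeIdeal_of_mul {k : Type} [Field k] {d n m : ℕ}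
    {f : MvPolynomial (Fin d ⊕ Fin d) k} {s : (Fin d ⊕ Fin d) →₀ ℕ}
    (hx : ∑ i, s (Sum.inl i) = m) (hy : ∑ i, s (Sum.inr i) = m)
    (hf : f * monomial s 1 ∈ bidegreeIdeal k d (n + m)) : f ∈ bidegreeIdeal k d n := by
  rw [mem_bidegreeIdeal_iff] at hf ⊢
  intro u hu
  have h := hf (u + s) (by
    rw [mem_support_iff, coeff_mul_monomial, mul_one]
    exact mem_support_iff.1 hu)
  simp only [Finsupp.add_apply, Finset.sum_add_distrib] at h
  omega

/-- Here the ideal `I` is the edge ideal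
`I(G_{d,a}) = x_1(y_1, …, y_d) + (x_i y_j : 2 ≤ i ≤ j ≤ a) + (x_i y_j : a+1 ≤ i ≤ j ≤ d)`
of the bipartite graph `G_{d,a}`, with `x_i = X (inl i)`, `y_i = X (inr i)` and `1`-based
indices translated to `0`-based `Fin d` indices.
Then `I(G_{d,a})^3 : (x_1 y_a x_1 y_d) = I(K_{d,d}) = (x_i y_j : 1 ≤ i, j ≤ d)`. -/
theorem colon_cube_two_drops_graph (k : Type) [Field k] (d a : ℕ)
    (hd : 5 ≤ d) (ha2 : 2 ≤ a) (had : a ≤ d - 1)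
    (I : Ideal (MvPolynomial (Fin d ⊕ Fin d) k))
    (hI : I = Ideal.span
      ({p | ∃ i : Fin d, p = X (Sum.inl (⟨0, by omega⟩ : Fin d)) * X (Sum.inr i)} ∪
       {p | ∃ i jm : Fin d, 1 ≤ (i : ℕ) ∧ i ≤ jm ∧ (jm : ℕ) < a ∧
          p = X (Sum.inl i) * X (Sum.inr jm)} ∪
       {p | ∃ i jm : Fin d, a ≤ (i : ℕ) ∧ i ≤ jm ∧
          p = X (Sum.inl i) * X (Sum.inr jm)})) :
    Submodule.colon (I ^ 3)
        (Ideal.span {(X (Sum.inl (⟨0, by omega⟩ : Fin d)) *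
            X (Sum.inr (⟨a - 1, by omega⟩ : Fin d)) *
            (X (Sum.inl (⟨0, by omega⟩ : Fin d)) *
              X (Sum.inr (⟨d - 1, by omega⟩ : Fin d))) : MvPolynomial (Fin d ⊕ Fin d) k)}) =
      Ideal.span {p : MvPolynomial (Fin d ⊕ Fin d) k |
        ∃ i jm : Fin d, p = X (Sum.inl i) * X (Sum.inr jm)} := by
  have hX0 : ∀ j : Fin d, X (Sum.inl (⟨0, by omega⟩ : Fin d)) * X (Sum.inr j) ∈ I := by
    intro j
    rw [hI]
    exact Ideal.subset_span (Or.inl (Or.inl ⟨j, rfl⟩))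
  have hI1 : I ≤ bidegreeIdeal k d 1 := by
    rw [hI, Ideal.span_le]
    rintro _ ((⟨j, rfl⟩ | ⟨i, j, -, -, -, rfl⟩) | ⟨i, j, -, -, rfl⟩) <;>
    exact X_mul_X_mem_bidegreeIdeal k _ _
  have hI3 : I ^ 3 ≤ bidegreeIdeal k d (1 + 2) := by
    rw [pow_succ', pow_two]
    exact (Ideal.mul_mono hI1 ((Ideal.mul_mono hI1 hI1).trans
      (bidegreeIdeal_mul_le k d 1 1))).trans (bidegreeIdeal_mul_le k d 1 2)
  have hmul : ∀ p q r : MvPolynomial (Fin d ⊕ Fin d) k, p ∈ I → q ∈ I → r ∈ I →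
      p * q * r ∈ I ^ 3 := by
    intro p q r hp hq hr
    rw [pow_succ, pow_two]
    exact Ideal.mul_mem_mul (Ideal.mul_mem_mul hp hq) hr
  apply le_antisymm
  · intro f hf
    have h := hI3 (Submodule.mem_colon.1 hf _ (Ideal.mem_span_singleton_self _))
    rw [smul_eq_mul, X_mul_X_eq_monomial, X_mul_X_eq_monomial, monomial_mul, mul_one] at h
    refine bidegreeIdeal_one_le k d (mem_bidegreeIdeal_of_mul ?_ ?_ h) <;>
    simp [Finsupp.single_apply, Finset.sum_add_distrib]
  · rw [Ideal.span_le]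
    rintro _ ⟨i, j, rfl⟩
    refine Submodule.mem_colon.2 fun g hg => ?_
    obtain ⟨c, rfl⟩ := Ideal.mem_span_singleton.1 hg
    rw [smul_eq_mul, ← mul_assoc]
    refine Ideal.mul_mem_right _ _ ?_
    by_cases hia : (i : ℕ) < a
    · have h : X (Sum.inl i) * X (Sum.inr (⟨a - 1, by omega⟩ : Fin d)) ∈ I := by
        by_cases hi0 : (i : ℕ) = 0
        · rw [show i = ⟨0, by omega⟩ from Fin.ext hi0]
          exact hX0 _
        · rw [hI]
          refine Ideal.subset_span (Or.inl (Or.inr ⟨i, _, by omega, ?_, ?_, rfl⟩))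
          · rw [Fin.le_def]
            dsimp only
            omega
          · dsimp only
            omega
      convert hmul _ _ _ h (hX0 j) (hX0 ⟨d - 1, by omega⟩) using 1
      ring
    · have h : X (Sum.inl i) * X (Sum.inr (⟨d - 1, by omega⟩ : Fin d)) ∈ I := by
        rw [hI]
        refine Ideal.subset_span (Or.inr ⟨i, _, by omega, ?_, rfl⟩)
        rw [Fin.le_def]
        dsimp only
        omega
      convert hmul _ _ _ h (hX0 j) (hX0 ⟨a - 1, by omega⟩) using 1
      ring
end

section
/- Let k be a field, d ≥ 5 an integer, S = k[x_1,…,x_d,y_1,…,y_d], and fix an integer a with 2 ≤ a ≤ d − 1. Let I(G_{d,a}) = x_1(y_1,…,y_d) + (x_i y_j : 2 ≤ i ≤ j ≤ a) + (x_i y_j : a+1 ≤ i ≤ j ≤ d). Then depth(S/(I(G_{d,a})^2 + (x_1))) = 1 + min(a, d − a + 1). -/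
open MvPolynomial

section

open CategoryTheory Abelian Limits

universe u

lemma CategoryTheory.ShortComplex.mono_homologyMap_of_elements {R : Type u} [Ring R]
    {S T : ShortComplex (ModuleCat.{u} R)} (χ : S ⟶ T)
    (h : ∀ x : S.X₂, S.g x = 0 → (∃ y : T.X₁, T.f y = χ.τ₂ x) → ∃ z : S.X₁, S.f z = x) :
    Mono (ShortComplex.homologyMap χ) := by
  rw [ShortComplex.mono_homologyMap_iff_up_to_refinements]
  intro A x₂ hx₂ y₁ hy
  have key : ∀ a : A, ∃ z : S.X₁, S.f z = x₂ a := fun a ↦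
    h _ (by simpa using ConcreteCategory.congr_hom hx₂ a)
      ⟨y₁ a, by simpa using (ConcreteCategory.congr_hom hy a).symm⟩
  choose z hz using key
  refine ⟨ModuleCat.of R (A →₀ R), ModuleCat.ofHom (Finsupp.linearCombination R id), ?_,
    ModuleCat.ofHom (Finsupp.linearCombination R z), ?_⟩
  · rw [ModuleCat.epi_iff_surjective]
    exact Finsupp.linearCombination_id_surjective R A
  · ext a
    simp [hz]

variable {R : Type u} [CommRing R]

lemma ModuleCat.mono_ext_map_of_injective {X X' Y : ModuleCat.{u} R} (g : X' ⟶ X) (n : ℕ)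
    (hn : n ≠ 0)
    (h : Function.Injective ((Ext.mk₀ g).precomp Y (zero_add n))) :
    Mono (((_root_.Ext R (ModuleCat.{u} R) n).map g.op).app Y) := by
  let P : ProjectiveResolution X := CategoryTheory.projectiveResolution X
  let P' : ProjectiveResolution X' := CategoryTheory.projectiveResolution X'
  let F := ((linearYoneda R (ModuleCat.{u} R)).obj Y).rightOp
  have hφ : (ProjectiveResolution.lift g P' P).f 0 ≫ P.π.f 0 = P'.π.f 0 ≫ g := by
    have := HomologicalComplex.congr_hom (ProjectiveResolution.lift_commutes g P' P) 0
    rw [HomologicalComplex.comp_f, HomologicalComplex.comp_f,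
      ChainComplex.single₀_map_f_zero] at this
    exact this
  let φ : ProjectiveResolution.Hom P' P g :=
    { hom := ProjectiveResolution.lift g P' P
      hom_f_zero_comp_π_f_zero := hφ }
  have e := ProjectiveResolution.isoLeftDerivedObj_hom_naturality g P' P φ.hom
    hφ F n
  change Mono ((F.leftDerived n).map g).unop
  have e' : (F.leftDerived n).map g = (P'.isoLeftDerivedObj F n).hom ≫
        (F.mapHomologicalComplex _ ⋙ HomologicalComplex.homologyFunctor _ _ n).map φ.hom ≫
        (P.isoLeftDerivedObj F n).inv := by
    rw [← Category.assoc, Iso.eq_comp_inv]; exact e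
  let K := (F.mapHomologicalComplex (ComplexShape.down ℕ)).obj P.complex
  let K' := (F.mapHomologicalComplex (ComplexShape.down ℕ)).obj P'.complex
  let ψ : K' ⟶ K := (F.mapHomologicalComplex (ComplexShape.down ℕ)).map φ.hom
  let χ : (K.sc n).unop ⟶ (K'.sc n).unop :=
    ShortComplex.unopMap ((HomologicalComplex.shortComplexFunctor _ _ n).map ψ)
  have hχ : Mono (ShortComplex.homologyMap χ) := by
    apply ShortComplex.mono_homologyMap_of_elements
    rintro x hx ⟨y, hy⟩
    have hm : n + 1 = (ComplexShape.down ℕ).prev n := by simp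
    have hp : (ComplexShape.down ℕ).next n + 1 = n := by
      obtain ⟨n, rfl⟩ := Nat.exists_eq_succ_of_ne_zero hn
      simp
    change P.complex.X n ⟶ Y at x
    change P.complex.d _ n ≫ x = 0 at hx
    change P'.complex.X _ ⟶ Y at y
    change P'.complex.d n _ ≫ y = φ.hom.f n ≫ x at hy
    have h0 : P.extMk x _ hm hx = 0 := by
      apply h
      change (Ext.mk₀ g).comp _ (zero_add n) = (Ext.mk₀ g).comp _ (zero_add n)
      rw [Ext.comp_zero, ProjectiveResolution.mk₀_comp_extMk _ _ _ _ φ,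
        ProjectiveResolution.extMk_eq_zero_iff _ _ _ _ _ _ hp]
      exact ⟨y, hy⟩
    rw [ProjectiveResolution.extMk_eq_zero_iff _ _ _ _ _ _ hp] at h0
    exact h0
  have hmid : Epi (ShortComplex.homologyMap (ShortComplex.opMap χ)) := by
    have := ShortComplex.homologyMap_op χ
    rw [eq_comm, Iso.inv_comp_eq, ← Iso.eq_comp_inv] at this
    rw [this]
    infer_instance
  have hmid' : Epi ((F.mapHomologicalComplex _ ⋙
      HomologicalComplex.homologyFunctor _ _ n).map φ.hom) := hmid
  have : Epi ((P'.isoLeftDerivedObj F n).hom ≫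
        (F.mapHomologicalComplex _ ⋙ HomologicalComplex.homologyFunctor _ _ n).map φ.hom ≫
        (P.isoLeftDerivedObj F n).inv) := inferInstance
  rw [e']
  infer_instance

lemma ModuleCat.isZero_ext_of_subsingleton {X Y : ModuleCat.{u} R} (n : ℕ)
    (h : Subsingleton (Ext X Y n)) :
    IsZero (((_root_.Ext R (ModuleCat.{u} R) n).obj (.op X)).obj Y) := by
  let P : ProjectiveResolution X := CategoryTheory.projectiveResolution X
  refine IsZero.of_iso ?_ (P.isoExt n Y)
  rw [← HomologicalComplex.exactAt_iff_isZero_homology, HomologicalComplex.exactAt_iff,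
    ShortComplex.moduleCat_exact_iff]
  intro x hx
  have hm : n + 1 = (ComplexShape.up ℕ).next n := by simp
  change P.complex.X n ⟶ Y at x
  change P.complex.d _ n ≫ x = 0 at hx
  have h0 : P.extMk x _ hm hx = 0 := Subsingleton.elim _ _
  obtain rfl | ⟨p, rfl⟩ : n = 0 ∨ ∃ p, n = p + 1 := by cases n <;> simp
  · obtain ⟨g, hg⟩ : ∃ g : X ⟶ Y, P.π.f 0 ≫ g = x := by
      have hx0 : P.complex.d 1 0 ≫ x = 0 := by rwa [CochainComplex.next] at hx
      obtain ⟨g, hg⟩ := CokernelCofork.IsColimit.desc' P.isColimitCokernelCofork x hx0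
      exact ⟨g, hg⟩
    have : g = 0 := by
      have : Subsingleton (X ⟶ Y) := Ext.addEquiv₀.symm.subsingleton
      exact Subsingleton.elim _ _
    refine ⟨0, ?_⟩
    rw [map_zero, ← hg, this]
    exact comp_zero.symm
  · rw [ProjectiveResolution.extMk_eq_zero_iff _ _ _ _ _ ((ComplexShape.up ℕ).prev (p + 1))
      (by simp)] at h0
    exact h0

lemma ModuleCat.subsingleton_ext_of_isZero {X Y : ModuleCat.{u} R} (n : ℕ) (hn : n ≠ 0)
    (h : IsZero (((_root_.Ext R (ModuleCat.{u} R) n).obj (.op X)).obj Y)) :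
    Subsingleton (Ext X Y n) := by
  let P : ProjectiveResolution X := CategoryTheory.projectiveResolution X
  obtain ⟨n, rfl⟩ := Nat.exists_eq_succ_of_ne_zero hn
  have h := h.of_iso (P.isoExt (n + 1) Y).symm
  rw [← HomologicalComplex.exactAt_iff_isZero_homology, HomologicalComplex.exactAt_iff,
    ShortComplex.moduleCat_exact_iff] at h
  refine subsingleton_of_forall_eq 0 fun α ↦ ?_
  obtain ⟨x, hx, rfl⟩ := P.extMk_surjective α _ rfl
  rw [ProjectiveResolution.extMk_eq_zero_iff _ _ _ _ _ n rfl]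
  have h2 := h x (by
    change P.complex.d ((ComplexShape.up ℕ).next (n + 1)) (n + 1) ≫ x = 0
    rw [CochainComplex.next]
    exact hx)
  obtain ⟨y, hy⟩ := h2
  change P.complex.X ((ComplexShape.up ℕ).prev (n + 1)) ⟶ Y at y
  change P.complex.d (n + 1) ((ComplexShape.up ℕ).prev (n + 1)) ≫ y = x at hy
  clear h hx
  revert y
  rw [CochainComplex.prev_nat_succ]
  exact fun y hy ↦ ⟨y, hy⟩

namespace localCohomology

/-- The local cohomology of a module is a colimit of its `Ext` modules. -/
noncomputable def isColimitEvaluation (J : Ideal R) (i : ℕ) (M : ModuleCat.{u} R) :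
    IsColimit (((evaluation _ _).obj M).mapCocone
      (colimit.cocone (diagram (idealPowersDiagram J) i))) :=
  isColimitOfPreserves _ (colimit.isColimit _)

lemma subsingleton_of_ext (J : Ideal R) (i : ℕ) (M : ModuleCat.{u} R)
    (h : ∀ n, Subsingleton (Ext (ModuleCat.of R (R ⧸ J ^ n)) M i)) :
    Subsingleton ((localCohomology J i).obj M) := by
  refine ModuleCat.subsingleton_of_isZero ((IsZero.iff_id_eq_zero _).2 ?_)
  refine (isColimitEvaluation J i M).hom_ext fun j ↦ ?_
  refine IsZero.eq_of_src (ModuleCat.isZero_ext_of_subsingleton i (h j.unop.unop)) _ _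

lemma nontrivial_of_ext {R : Type} [CommRing R] (J : Ideal R) (i : ℕ) (hi : i ≠ 0)
    (M : ModuleCat.{0} R)
    (h : Nontrivial (Ext (ModuleCat.of R (R ⧸ J ^ 1)) M i))
    (hinj : ∀ n (hn : 1 ≤ n), Function.Injective
      ((Ext.mk₀ (ModuleCat.ofHom (Submodule.mapQ (J ^ n) (J ^ 1) LinearMap.id
        (Ideal.pow_le_pow_right hn)))).precomp M (zero_add i))) :
    Nontrivial ((localCohomology J i).obj M) := by
  by_contra! hs
  have hz : ¬ IsZero (((_root_.Ext R (ModuleCat.{0} R) i).obj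
      (.op (ModuleCat.of R (R ⧸ J ^ 1)))).obj M) := fun hz ↦
    not_subsingleton _ (ModuleCat.subsingleton_ext_of_isZero i hi hz)
  rw [ModuleCat.isZero_iff_subsingleton, not_subsingleton_iff_nontrivial] at hz
  obtain ⟨x, hx⟩ := exists_ne (0 : ((_root_.Ext R (ModuleCat.{0} R) i).obj
      (.op (ModuleCat.of R (R ⧸ J ^ 1)))).obj M)
  let j : (ℕᵒᵖ)ᵒᵖ := .op (.op 1)
  have hc := isColimitEvaluation J i M
  obtain ⟨k, f, g, hfg⟩ := Concrete.isColimit_exists_of_rep_eq.{0} _ hc (i := j) (j := j) x 0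
    (hs.elim _ _)
  obtain rfl : f = g := Subsingleton.elim _ _
  rw [map_zero] at hfg
  have hk : 1 ≤ k.unop.unop := f.unop.unop.down.down
  have hm := ModuleCat.mono_ext_map_of_injective _ i hi (hinj _ hk)
  refine hx ((ModuleCat.mono_iff_injective _).1 hm (a₂ := 0) ?_)
  rw [map_zero]
  exact hfg

end localCohomology

lemma Ideal.support_quotient_pow_subset (m : Ideal R) (n : ℕ) :
    Module.support R (R ⧸ m ^ n) ⊆ PrimeSpectrum.zeroLocus m := by
  rw [Module.support_eq_zeroLocus, Ideal.annihilator_quotient]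
  obtain rfl | hn := eq_or_ne n 0
  · simp
  · rw [PrimeSpectrum.zeroLocus_pow m hn]

/-- The depth of a finite module, defined by vanishing of local cohomology, is detected by
`Ext` from the residue ring. -/
theorem localCohomology.sInf_nontrivial_eq {R : Type} [CommRing R] [IsNoetherianRing R]
    (m : Ideal R) (M : ModuleCat.{0} R) [Module.Finite R M]
    (hM : m • (⊤ : Submodule R M) < ⊤) (D : ℕ) (hD : D ≠ 0)
    (h : ∀ i < D, Subsingleton (Ext (ModuleCat.of R (R ⧸ m)) M i))
    (h' : Nontrivial (Ext (ModuleCat.of R (R ⧸ m)) M D)) :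
    sInf {i : ℕ | Nontrivial ((localCohomology m i).obj M)} = D := by
  obtain ⟨rs, hlen, hmem, hreg⟩ := ModuleCat.exists_isRegular_of_exists_subsingleton_ext m D M hM
    (ModuleCat.of R (R ⧸ m)) 
    (by rw [Module.support_eq_zeroLocus, Ideal.annihilator_quotient]) h
  have key : ∀ (N : ModuleCat.{0} R) [Module.Finite R N],
      Module.support R N ⊆ PrimeSpectrum.zeroLocus m → ∀ i < D, Subsingleton (Ext N M i) := by
    intro N _ hN
    rw [← hlen]
    exact ModuleCat.subsingleton_ext_of_exists_isRegular m N hN M hM rs hmem hreg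
  refine le_antisymm (Nat.sInf_le ?_) (le_csInf ⟨D, ?_⟩ fun i hi ↦ ?_)
  case refine_3 =>
    by_contra! hlt
    have := localCohomology.subsingleton_of_ext m i M fun n ↦
      key (ModuleCat.of R (R ⧸ m ^ n)) (m.support_quotient_pow_subset n) i hlt
    exact not_subsingleton_iff_nontrivial.2 hi this
  all_goals
    refine localCohomology.nontrivial_of_ext m D hD M ?_ fun n hn ↦ ?_
    · rwa [pow_one]
    · set f : (R ⧸ m ^ n) →ₗ[R] (R ⧸ m ^ 1) := Submodule.mapQ (m ^ n) (m ^ 1) LinearMap.id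
        (Ideal.pow_le_pow_right hn)
      have hf : Function.Surjective f := by
        rintro ⟨x⟩
        exact ⟨Submodule.Quotient.mk x, rfl⟩
      have hS := LinearMap.shortExact_shortComplexKer hf
      have hK := key (ModuleCat.of R (LinearMap.ker f))
        ((Module.support_subset_of_injective (LinearMap.ker f).subtype
          Subtype.val_injective).trans (m.support_quotient_pow_subset n)) (D - 1) (by lia)
      rw [injective_iff_map_eq_zero]
      intro x hx
      obtain ⟨y, rfl⟩ := Ext.contravariant_sequence_exact₃ hS M x hx (n₀ := D - 1) (by lia)
      have : y = 0 := hK.elim _ _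
      rw [this, Ext.comp_zero]

section
variable {M₁ M₂ M₃ : Type u} [AddCommGroup M₁] [AddCommGroup M₂] [AddCommGroup M₃]
  [Module R M₁] [Module R M₂] [Module R M₃]

lemma ModuleCat.shortExact_of_linearMap {f : M₁ →ₗ[R] M₂} {g : M₂ →ₗ[R] M₃}
    (hf : Function.Injective f) (hfg : Function.Exact f g) (hg : Function.Surjective g) :
    (ModuleCat.shortComplexOfCompEqZero f g hfg.linearMap_comp_eq_zero).ShortExact where
  exact := ModuleCat.shortComplex_exact _ hfg
  mono_f := (ModuleCat.mono_iff_injective _).2 hf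
  epi_g := (ModuleCat.epi_iff_surjective _).2 hg

variable {X : ModuleCat.{u} R} {f : M₁ →ₗ[R] M₂} {g : M₂ →ₗ[R] M₃}
    (hf : Function.Injective f) (hfg : Function.Exact f g) (hg : Function.Surjective g)
include hf hfg hg

lemma ModuleCat.subsingleton_ext_middle {i : ℕ}
    (h₁ : Subsingleton (Ext X (ModuleCat.of R M₁) i))
    (h₃ : Subsingleton (Ext X (ModuleCat.of R M₃) i)) :
    Subsingleton (Ext X (ModuleCat.of R M₂) i) := by
  have hS := ModuleCat.shortExact_of_linearMap hf hfg hg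
  refine subsingleton_of_forall_eq 0 fun x ↦ ?_
  obtain ⟨y, rfl⟩ := Ext.covariant_sequence_exact₂ X hS x (h₃.elim _ _)
  obtain rfl : y = 0 := h₁.elim _ _
  rw [Ext.zero_comp]

lemma ModuleCat.subsingleton_ext_left {i : ℕ}
    (h₃ : Subsingleton (Ext X (ModuleCat.of R M₃) i))
    (h₂ : Subsingleton (Ext X (ModuleCat.of R M₂) (i + 1))) :
    Subsingleton (Ext X (ModuleCat.of R M₁) (i + 1)) := by
  have hS := ModuleCat.shortExact_of_linearMap hf hfg hg
  refine subsingleton_of_forall_eq 0 fun x ↦ ?_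
  obtain ⟨y, rfl⟩ := Ext.covariant_sequence_exact₁ X hS x (h₂.elim _ _) rfl
  obtain rfl : y = 0 := h₃.elim _ _
  rw [Ext.zero_comp]

lemma ModuleCat.subsingleton_ext_right {i : ℕ}
    (h₂ : Subsingleton (Ext X (ModuleCat.of R M₂) i))
    (h₁ : Subsingleton (Ext X (ModuleCat.of R M₁) (i + 1))) :
    Subsingleton (Ext X (ModuleCat.of R M₃) i) := by
  have hS := ModuleCat.shortExact_of_linearMap hf hfg hg
  refine subsingleton_of_forall_eq 0 fun x ↦ ?_
  obtain ⟨y, rfl⟩ := Ext.covariant_sequence_exact₃ X hS x rfl (h₁.elim _ _)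
  obtain rfl : y = 0 := h₂.elim _ _
  rw [Ext.zero_comp]

end

lemma ModuleCat.subsingleton_ext_zero_of_injective {M₁ M₂ : Type u} [AddCommGroup M₁]
    [AddCommGroup M₂] [Module R M₁] [Module R M₂] {X : ModuleCat.{u} R} {f : M₁ →ₗ[R] M₂}
    (hf : Function.Injective f) (h₂ : Subsingleton (Ext X (ModuleCat.of R M₂) 0)) :
    Subsingleton (Ext X (ModuleCat.of R M₁) 0) := by
  have : Mono (ModuleCat.ofHom f) := (ModuleCat.mono_iff_injective _).2 hf
  exact (Ext.postcomp_mk₀_injective_of_mono X (ModuleCat.ofHom f)).subsingleton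

lemma ModuleCat.subsingleton_ext_of_smul {M N : Type u} [AddCommGroup M] [AddCommGroup N]
    [Module R M] [Module R N] {X : ModuleCat.{u} R} {f : M →ₗ[R] M} {g : M →ₗ[R] N}
    (hf : Function.Injective f) (hfg : Function.Exact f g) (hg : Function.Surjective g) {r : R}
    (hfr : ∀ x, f x = r • x) (hr : r ∈ Module.annihilator R X) :
    Subsingleton (Ext X (ModuleCat.of R M) 0) ∧
      ∀ i, Subsingleton (Ext X (ModuleCat.of R N) i) →
        Subsingleton (Ext X (ModuleCat.of R M) (i + 1)) := by
  have hS := ModuleCat.shortExact_of_linearMap hf hfg hg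
  have hfr' : ModuleCat.ofHom f = r • 𝟙 (ModuleCat.of R M) := by
    ext x
    exact hfr x
  have hz (i : ℕ) (x : Ext X (ModuleCat.of R M) i) :
      x.comp (Ext.mk₀ (ModuleCat.ofHom f)) (add_zero i) = 0 := by
    have hX : r • 𝟙 X = 0 := by
      simp [← ModuleCat.lsmul_eq_smul_id, Module.mem_annihilator_iff_lsmul_eq_zero.mp hr]
    have h1 : r • x = (Ext.mk₀ (r • 𝟙 X)).comp x (zero_add i) := by simp [Ext.mk₀_smul]
    rw [hX, Ext.mk₀_zero, Ext.zero_comp] at h1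
    rw [hfr']
    simpa [Ext.mk₀_smul] using h1
  refine ⟨subsingleton_of_forall_eq 0 fun x ↦ ?_, fun i hi ↦ subsingleton_of_forall_eq 0 fun x ↦ ?_⟩
  · have : Mono (ModuleCat.ofHom f) := (ModuleCat.mono_iff_injective _).2 hf
    apply Ext.postcomp_mk₀_injective_of_mono X (ModuleCat.ofHom f)
    rw [map_zero]
    exact hz 0 x
  · obtain ⟨y, rfl⟩ := Ext.covariant_sequence_exact₁ _ hS x (hz _ x) rfl
    obtain rfl : y = 0 := hi.elim _ _
    rw [Ext.zero_comp]

/-- The ideal `I` has vanishing `Ext` modules `Ext^i(R/m, R/I)` for `i < t`. -/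
def Ideal.DepthGE (m I : Ideal R) (t : ℕ) : Prop :=
  ∀ i < t, Subsingleton (Ext (ModuleCat.of R (R ⧸ m)) (ModuleCat.of R (R ⧸ I)) i)

namespace Ideal

variable {m I J A C : Ideal R} {r : R} {t : ℕ}

lemma DepthGE.mono {s : ℕ} (h : m.DepthGE I t) (hst : s ≤ t) : m.DepthGE I s :=
  fun i hi ↦ h i (hi.trans_le hst)

lemma colon_injective (hC : ∀ x, x ∈ C ↔ r * x ∈ I) :
    Function.Injective (Submodule.mapQ C I (LinearMap.mulLeft R r) fun x hx ↦ (hC x).1 hx) := by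
  rw [injective_iff_map_eq_zero]
  rintro ⟨x⟩ hx
  exact (Submodule.Quotient.mk_eq_zero _).2
    ((hC x).2 ((Submodule.Quotient.mk_eq_zero _).1 hx))

lemma colon_exact (hC : ∀ x, x ∈ C ↔ r * x ∈ I) :
    Function.Exact (Submodule.mapQ C I (LinearMap.mulLeft R r) fun x hx ↦ (hC x).1 hx)
      (Submodule.mapQ I (I ⊔ span {r}) LinearMap.id le_sup_left) := by
  rintro ⟨y⟩
  refine Iff.trans (Submodule.Quotient.mk_eq_zero (I ⊔ span {r})) ?_
  rw [Submodule.mem_sup]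
  constructor
  · rintro ⟨a, ha, b, hb, hab⟩
    obtain ⟨x, rfl⟩ := mem_span_singleton'.1 hb
    refine ⟨Submodule.Quotient.mk x, (Submodule.Quotient.eq I).2 ?_⟩
    have : r * x - y = - a := by
      rw [show y = a + x * r from hab.symm]
      ring
    change r * x - y ∈ I
    rw [this]
    exact neg_mem ha
  · rintro ⟨⟨x⟩, hx⟩
    have hx : r * x - y ∈ I := (Submodule.Quotient.eq I).1 hx
    exact ⟨_, neg_mem hx, r * x, mem_span_singleton'.2 ⟨x, mul_comm _ _⟩, by simp⟩

lemma mapQ_id_surjective (h : I ≤ J) :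
    Function.Surjective (Submodule.mapQ I J LinearMap.id h) := by
  rintro ⟨x⟩
  exact ⟨Submodule.Quotient.mk x, rfl⟩

lemma DepthGE.of_colon (hC : ∀ x, x ∈ C ↔ r * x ∈ I) (h : m.DepthGE C t)
    (h' : m.DepthGE (I ⊔ span {r}) t) : m.DepthGE I t := fun i hi ↦
  ModuleCat.subsingleton_ext_middle (colon_injective hC) (colon_exact hC)
    (mapQ_id_surjective _) (h i hi) (h' i hi)

lemma DepthGE.colon (hC : ∀ x, x ∈ C ↔ r * x ∈ I) (h : m.DepthGE I (t + 1))
    (h' : m.DepthGE (I ⊔ span {r}) t) : m.DepthGE C (t + 1) := by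
  rintro (_ | i) hi
  · exact ModuleCat.subsingleton_ext_zero_of_injective (colon_injective hC) (h 0 hi)
  · exact ModuleCat.subsingleton_ext_left (colon_injective hC) (colon_exact hC)
      (mapQ_id_surjective _) (h' i (by lia)) (h (i + 1) hi)

lemma DepthGE.of_regular (hC : ∀ x, x ∈ I ↔ r * x ∈ I) (hr : r ∈ m)
    (h' : m.DepthGE (I ⊔ span {r}) t) : m.DepthGE I (t + 1) := by
  have hs := ModuleCat.subsingleton_ext_of_smul (X := ModuleCat.of R (R ⧸ m))
    (colon_injective hC) (colon_exact hC) (mapQ_id_surjective _) (r := r)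
    (by rintro ⟨x⟩; rfl) (by rwa [Ideal.annihilator_quotient])
  rintro (_ | i) hi
  · exact hs.1
  · exact hs.2 i (h' i (by lia))

lemma DepthGE.sup_span (hC : ∀ x, x ∈ I ↔ r * x ∈ I) (h : m.DepthGE I (t + 1)) :
    m.DepthGE (I ⊔ span {r}) t := fun i hi ↦
  ModuleCat.subsingleton_ext_right (colon_injective hC) (colon_exact hC) (mapQ_id_surjective _)
    (h i (by lia)) (h (i + 1) (by lia))

lemma inf_injective : Function.Injective ((Submodule.mapQ (A ⊓ C) A LinearMap.id inf_le_left).prod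
    (Submodule.mapQ (A ⊓ C) C LinearMap.id inf_le_right)) := by
  rw [injective_iff_map_eq_zero]
  rintro ⟨x⟩ hx
  obtain ⟨h₁, h₂⟩ := Prod.ext_iff.1 hx
  exact (Submodule.Quotient.mk_eq_zero _).2
    ⟨(Submodule.Quotient.mk_eq_zero A).1 h₁, (Submodule.Quotient.mk_eq_zero C).1 h₂⟩

lemma inf_exact : Function.Exact ((Submodule.mapQ (A ⊓ C) A LinearMap.id inf_le_left).prod
    (Submodule.mapQ (A ⊓ C) C LinearMap.id inf_le_right))
    ((Submodule.mapQ A (A ⊔ C) LinearMap.id le_sup_left).coprod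
      (-Submodule.mapQ C (A ⊔ C) LinearMap.id le_sup_right)) := by
  rintro ⟨⟨x⟩, ⟨y⟩⟩
  have : Submodule.Quotient.mk x + -Submodule.Quotient.mk y = (0 : R ⧸ (A ⊔ C)) ↔
      x - y ∈ A ⊔ C := by
    rw [← sub_eq_add_neg, sub_eq_zero, Submodule.Quotient.eq]
  refine this.trans ?_
  rw [Submodule.mem_sup]
  constructor
  · rintro ⟨a, ha, c, hc, hac⟩
    refine ⟨Submodule.Quotient.mk (x - a), Prod.ext ((Submodule.Quotient.eq A).2 ?_)
      ((Submodule.Quotient.eq C).2 ?_)⟩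
    · change x - a - x ∈ A
      simpa using ha
    · change x - a - y ∈ C
      have : x - a - y = c := by linear_combination - hac
      rwa [this]
  · rintro ⟨⟨z⟩, hz⟩
    obtain ⟨h₁, h₂⟩ := Prod.ext_iff.1 hz
    have h₁ : z - x ∈ A := (Submodule.Quotient.eq A).1 h₁
    have h₂ : z - y ∈ C := (Submodule.Quotient.eq C).1 h₂
    exact ⟨_, neg_mem h₁, _, h₂, by ring⟩

lemma coprod_surjective : Function.Surjective
    ((Submodule.mapQ A (A ⊔ C) LinearMap.id le_sup_left).coprod
      (-Submodule.mapQ C (A ⊔ C) LinearMap.id le_sup_right)) := by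
  rintro ⟨x⟩
  exact ⟨(Submodule.Quotient.mk x, 0), by simp; rfl⟩

lemma DepthGE.subsingleton_ext_prod (hA : m.DepthGE A t) (hC : m.DepthGE C t) {i : ℕ}
    (hi : i < t) : Subsingleton (Ext (ModuleCat.of R (R ⧸ m))
      (ModuleCat.of R ((R ⧸ A) × (R ⧸ C))) i) :=
  ModuleCat.subsingleton_ext_middle (f := LinearMap.inl R (R ⧸ A) (R ⧸ C))
    (g := LinearMap.snd R (R ⧸ A) (R ⧸ C)) LinearMap.inl_injective
    Function.Exact.inl_snd LinearMap.snd_surjective (hA i hi) (hC i hi)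

lemma DepthGE.inf (hA : m.DepthGE A (t + 1)) (hC : m.DepthGE C (t + 1))
    (h : m.DepthGE (A ⊔ C) t) : m.DepthGE (A ⊓ C) (t + 1) := by
  rintro (_ | i) hi
  · exact ModuleCat.subsingleton_ext_zero_of_injective inf_injective
      (hA.subsingleton_ext_prod hC hi)
  · exact ModuleCat.subsingleton_ext_left inf_injective inf_exact coprod_surjective
      (h i (by lia)) (hA.subsingleton_ext_prod hC hi)

lemma DepthGE.sup (hA : m.DepthGE A t) (hC : m.DepthGE C t) (h : m.DepthGE (A ⊓ C) (t + 1)) :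
    m.DepthGE (A ⊔ C) t := fun i hi ↦
  ModuleCat.subsingleton_ext_right inf_injective inf_exact coprod_surjective
    (hA.subsingleton_ext_prod hC hi) (h (i + 1) (by lia))

lemma not_depthGE_self (hm : m ≠ ⊤) : ¬ m.DepthGE m 1 := by
  intro h
  have h0 := h 0 one_pos
  have : Subsingleton (ModuleCat.of R (R ⧸ m) ⟶ ModuleCat.of R (R ⧸ m)) :=
    Ext.addEquiv₀.symm.subsingleton
  have h1 : 𝟙 (ModuleCat.of R (R ⧸ m)) = 0 := Subsingleton.elim _ _
  have h2 := ConcreteCategory.congr_hom h1 (Submodule.Quotient.mk 1)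
  exact hm ((eq_top_iff_one m).2 ((Submodule.Quotient.mk_eq_zero m).1 h2))

end Ideal

end

namespace MvPolynomial

section

variable (k : Type) [Field k] {σ : Type}

/-- The monomial ideal spanned by the monomials with exponent in `U`. -/
noncomputable def monoIdeal (U : UpperSet (σ →₀ ℕ)) : Ideal (MvPolynomial σ k) :=
  Ideal.span ((fun s ↦ monomial s (1 : k)) '' U)

variable {k}

lemma mem_monoIdeal {U : UpperSet (σ →₀ ℕ)} {f : MvPolynomial σ k} :
    f ∈ monoIdeal k U ↔ ∀ s ∈ f.support, s ∈ U := by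
  rw [monoIdeal, mem_ideal_span_monomial_image]
  exact forall₂_congr fun s _ ↦ ⟨fun ⟨u, hu, hus⟩ ↦ U.upper hus hu, fun h ↦ ⟨s, h, le_rfl⟩⟩

lemma monomial_mem_monoIdeal {U : UpperSet (σ →₀ ℕ)} {s : σ →₀ ℕ} :
    monomial s (1 : k) ∈ monoIdeal k U ↔ s ∈ U := by
  classical
  rw [mem_monoIdeal, support_monomial, if_neg one_ne_zero]
  simp

lemma mem_monoIdeal_colon {U C : UpperSet (σ →₀ ℕ)} {e : σ →₀ ℕ}
    (hC : ∀ s, s ∈ C ↔ s + e ∈ U) (f : MvPolynomial σ k) :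
    f ∈ monoIdeal k C ↔ monomial e 1 * f ∈ monoIdeal k U := by
  rw [mem_monoIdeal, mem_monoIdeal]
  constructor
  · intro h s hs
    rw [mem_support_iff, coeff_monomial_mul'] at hs
    obtain ⟨hle, hs⟩ := ite_ne_right_iff.1 hs
    rw [one_mul] at hs
    have := (hC _).1 (h (s - e) (mem_support_iff.2 hs))
    rwa [tsub_add_cancel_of_le hle] at this
  · intro h s hs
    refine (hC s).2 (h _ ?_)
    rw [add_comm, mem_support_iff, coeff_monomial_mul, one_mul]
    exact mem_support_iff.1 hs

lemma monoIdeal_eq_sup_span {U A : UpperSet (σ →₀ ℕ)} {e : σ →₀ ℕ}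
    (hA : ∀ s, s ∈ A ↔ s ∈ U ∨ e ≤ s) :
    monoIdeal k A = monoIdeal k U ⊔ Ideal.span {monomial e 1} := by
  apply le_antisymm
  · refine Ideal.span_le.2 ?_
    rintro _ ⟨s, hs, rfl⟩
    obtain h | h := (hA s).1 hs
    · exact Ideal.mem_sup_left (Ideal.subset_span ⟨s, h, rfl⟩)
    · refine Ideal.mem_sup_right (Ideal.mem_span_singleton.2 ⟨monomial (s - e) 1, ?_⟩)
      simp [monomial_mul, add_tsub_cancel_of_le h]
  · refine sup_le (Ideal.span_mono (Set.image_mono fun s hs ↦ (hA s).2 (.inl hs))) ?_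
    rw [Ideal.span_singleton_le_iff_mem, monomial_mem_monoIdeal, hA]
    exact .inr le_rfl

lemma monoIdeal_eq_inf {A B U : UpperSet (σ →₀ ℕ)} (hU : ∀ s, s ∈ U ↔ s ∈ A ∧ s ∈ B) :
    monoIdeal k U = monoIdeal k A ⊓ monoIdeal k B := by
  ext f
  simp only [Submodule.mem_inf, mem_monoIdeal, hU]
  grind

lemma monoIdeal_eq_sup {A B U : UpperSet (σ →₀ ℕ)} (hU : ∀ s, s ∈ U ↔ s ∈ A ∨ s ∈ B) :
    monoIdeal k U = monoIdeal k A ⊔ monoIdeal k B := by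
  rw [monoIdeal, monoIdeal, monoIdeal, ← Ideal.span_union, ← Set.image_union]
  congr 2
  ext s
  exact hU s

variable (k) in
/-- The depth of the quotient by the monomial ideal of `U` is at least `t`. -/
def DepthGE (U : UpperSet (σ →₀ ℕ)) (t : ℕ) : Prop :=
  (maxHomIdeal k σ).DepthGE (monoIdeal k U) t

namespace DepthGE

variable {U A B C : UpperSet (σ →₀ ℕ)} {e : σ →₀ ℕ} {t s : ℕ}

lemma mono (h : DepthGE k U t) (hst : s ≤ t) : DepthGE k U s := Ideal.DepthGE.mono h hst

lemma of_colon (hC : ∀ s, s ∈ C ↔ s + e ∈ U) (hA : ∀ s, s ∈ A ↔ s ∈ U ∨ e ≤ s)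
    (h : DepthGE k C t) (h' : DepthGE k A t) : DepthGE k U t := by
  refine Ideal.DepthGE.of_colon (mem_monoIdeal_colon hC) h ?_
  rw [← monoIdeal_eq_sup_span hA]
  exact h'

lemma colon (hC : ∀ s, s ∈ C ↔ s + e ∈ U) (hA : ∀ s, s ∈ A ↔ s ∈ U ∨ e ≤ s)
    (h : DepthGE k U (t + 1)) (h' : DepthGE k A t) : DepthGE k C (t + 1) := by
  refine Ideal.DepthGE.colon (mem_monoIdeal_colon hC) h ?_
  rw [← monoIdeal_eq_sup_span hA]
  exact h'

lemma _root_.MvPolynomial.depthGE_succ_iff {v : σ} (hv : ∀ s, s + Finsupp.single v 1 ∈ U → s ∈ U)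
    (hA : ∀ s, s ∈ A ↔ s ∈ U ∨ s v ≠ 0) : DepthGE k U (t + 1) ↔ DepthGE k A t := by
  have hC (f : MvPolynomial σ k) : f ∈ monoIdeal k U ↔
      monomial (Finsupp.single v 1) 1 * f ∈ monoIdeal k U :=
    mem_monoIdeal_colon (fun s ↦ ⟨U.upper le_self_add, hv s⟩) f
  have hA' := monoIdeal_eq_sup_span (k := k) (U := U) (A := A) (e := Finsupp.single v 1) (by
    intro s
    rw [hA, Finsupp.single_le_iff, Nat.one_le_iff_ne_zero])
  rw [DepthGE, DepthGE, hA']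
  exact ⟨Ideal.DepthGE.sup_span hC,
    Ideal.DepthGE.of_regular hC (Ideal.subset_span ⟨v, rfl⟩)⟩

lemma inf (hU : ∀ s, s ∈ U ↔ s ∈ A ∧ s ∈ B) (hC : ∀ s, s ∈ C ↔ s ∈ A ∨ s ∈ B)
    (hA : DepthGE k A (t + 1)) (hB : DepthGE k B (t + 1)) (h : DepthGE k C t) :
    DepthGE k U (t + 1) := by
  rw [DepthGE, monoIdeal_eq_inf hU]
  rw [DepthGE, monoIdeal_eq_sup hC] at h
  exact Ideal.DepthGE.inf hA hB h

lemma sup (hU : ∀ s, s ∈ U ↔ s ∈ A ∧ s ∈ B) (hC : ∀ s, s ∈ C ↔ s ∈ A ∨ s ∈ B)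
    (hA : DepthGE k A t) (hB : DepthGE k B t) (h : DepthGE k U (t + 1)) :
    DepthGE k C t := by
  rw [DepthGE, monoIdeal_eq_sup hC]
  rw [DepthGE, monoIdeal_eq_inf hU] at h
  exact Ideal.DepthGE.sup hA hB h

lemma zero : DepthGE k U 0 := fun i hi ↦ absurd hi (Nat.not_lt_zero i)

end DepthGE

lemma maxHomIdeal_ne_top : maxHomIdeal k σ ≠ ⊤ := by
  intro h
  have : maxHomIdeal k σ ≤ RingHom.ker (constantCoeff (σ := σ) (R := k)) := by
    rw [maxHomIdeal, Ideal.span_le]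
    rintro _ ⟨v, rfl⟩
    simp [RingHom.mem_ker]
  have h1 : constantCoeff (1 : MvPolynomial σ k) = 0 := this (h ▸ Submodule.mem_top)
  exact one_ne_zero ((map_one constantCoeff).symm.trans h1)

lemma monomial_dvd_monomial_of_le {s t : σ →₀ ℕ} (h : s ≤ t) :
    monomial s (1 : k) ∣ monomial t 1 :=
  ⟨monomial (t - s) 1, by rw [monomial_mul, one_mul, add_tsub_cancel_of_le h]⟩

lemma monoIdeal_le_maxHomIdeal {U : UpperSet (σ →₀ ℕ)} (hU : 0 ∉ U) :
    monoIdeal k U ≤ maxHomIdeal k σ := by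
  refine Ideal.span_le.2 ?_
  rintro _ ⟨s, hs, rfl⟩
  obtain ⟨v, hv⟩ := Finsupp.ne_iff.1 (show s ≠ 0 by rintro rfl; exact hU hs)
  refine Ideal.mem_of_dvd _ (monomial_dvd_monomial_of_le ?_) (Ideal.subset_span ⟨v, rfl⟩)
  simpa [Nat.one_le_iff_ne_zero] using hv

lemma not_depthGE_one {U : UpperSet (σ →₀ ℕ)} (hU : ∀ s, s ∈ U ↔ s ≠ 0) : ¬ DepthGE k U 1 := by
  have : monoIdeal k U = maxHomIdeal k σ := by
    apply le_antisymm
    · exact monoIdeal_le_maxHomIdeal (by simp [hU])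
    · refine Ideal.span_le.2 ?_
      rintro _ ⟨v, rfl⟩
      refine monomial_mem_monoIdeal.2 ((hU _).2 (by simp))
  rw [DepthGE, this]
  exact Ideal.not_depthGE_self maxHomIdeal_ne_top

end

section

variable {k : Type} [Field k] {ι : Type} {E : ι → ι → Prop}

/-- The exponents of the monomials lying in the ideal generated by the variables `x_p` for `p ∈ X`,
the variables `y_q` for `q ∈ Y`, and the products `x_p y_q` with `E p q`. -/
def graphUpperSet (X Y : Finset ι) (E : ι → ι → Prop) : UpperSet (ι ⊕ ι →₀ ℕ) where
  carrier := {s | (∃ p ∈ X, s (.inl p) ≠ 0) ∨ (∃ q ∈ Y, s (.inr q) ≠ 0) ∨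
    ∃ p q, E p q ∧ s (.inl p) ≠ 0 ∧ s (.inr q) ≠ 0}
  upper' := by
    intro s t hst h
    have h0 : ∀ v, s v ≠ 0 → t v ≠ 0 := fun v hv ↦
      (Nat.pos_of_ne_zero hv |>.trans_le (hst v)).ne'
    rcases h with ⟨p, hp, h⟩ | ⟨q, hq, h⟩ | ⟨p, q, hE, h, h'⟩
    · exact .inl ⟨p, hp, h0 _ h⟩
    · exact .inr (.inl ⟨q, hq, h0 _ h⟩)
    · exact .inr (.inr ⟨p, q, hE, h0 _ h, h0 _ h'⟩)

lemma mem_graphUpperSet {X Y : Finset ι} {s : ι ⊕ ι →₀ ℕ} :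
    s ∈ graphUpperSet X Y E ↔ (∃ p ∈ X, s (.inl p) ≠ 0) ∨ (∃ q ∈ Y, s (.inr q) ≠ 0) ∨
      ∃ p q, E p q ∧ s (.inl p) ≠ 0 ∧ s (.inr q) ≠ 0 :=
  Iff.rfl

variable [DecidableEq ι]

lemma add_single_apply_ne_zero {σ : Type} {s : σ →₀ ℕ} {v w : σ} :
    (s + Finsupp.single v 1 : σ →₀ ℕ) w ≠ 0 ↔ s w ≠ 0 ∨ w = v := by
  classical
  rw [Finsupp.add_apply, Finsupp.single_apply]
  grind

lemma depthGE_graphUpperSet_insert_left {X Y : Finset ι} {p : ι} (hp : p ∉ X)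
    (h : ∀ q, E p q → q ∈ Y) (t : ℕ) :
    DepthGE k (graphUpperSet X Y E) (t + 1) ↔ DepthGE k (graphUpperSet (insert p X) Y E) t := by
  refine depthGE_succ_iff (v := .inl p) ?_ ?_
  · intro s
    simp only [mem_graphUpperSet, add_single_apply_ne_zero, Sum.inl.injEq, reduceCtorEq, or_false]
    grind
  · intro s
    simp only [mem_graphUpperSet]
    grind

lemma depthGE_graphUpperSet_insert_right {X Y : Finset ι} {q : ι} (hq : q ∉ Y)
    (h : ∀ p, E p q → p ∈ X) (t : ℕ) :
    DepthGE k (graphUpperSet X Y E) (t + 1) ↔ DepthGE k (graphUpperSet X (insert q Y) E) t := by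
  refine depthGE_succ_iff (v := .inr q) ?_ ?_
  · intro s
    simp only [mem_graphUpperSet, add_single_apply_ne_zero, Sum.inr.injEq, reduceCtorEq, or_false]
    grind
  · intro s
    simp only [mem_graphUpperSet]
    grind

lemma mem_graphUpperSet_insert_left {X Y : Finset ι} {p : ι} {s : ι ⊕ ι →₀ ℕ} :
    s ∈ graphUpperSet (insert p X) Y E ↔
      s ∈ graphUpperSet X Y E ∨ Finsupp.single (.inl p) 1 ≤ s := by
  rw [Finsupp.single_le_iff, Nat.one_le_iff_ne_zero]
  simp only [mem_graphUpperSet]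
  grind

lemma mem_graphUpperSet_colon {X Y Z : Finset ι} {p : ι} (hp : p ∉ X) (hZ : ∀ q, q ∈ Z ↔ E p q)
    {s : ι ⊕ ι →₀ ℕ} :
    s ∈ graphUpperSet X (Y ∪ Z) E ↔ s + Finsupp.single (.inl p) 1 ∈ graphUpperSet X Y E := by
  simp only [mem_graphUpperSet, add_single_apply_ne_zero, Sum.inl.injEq, reduceCtorEq, or_false]
  grind

variable [Fintype ι]

lemma card_compl_insert {X : Finset ι} {p : ι} (hp : p ∉ X) {n : ℕ} (hn : Xᶜ.card = n + 1) :
    (insert p X)ᶜ.card = n := by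
  rw [Finset.compl_insert, Finset.card_erase_of_mem (Finset.mem_compl.2 hp), hn]
  rfl

lemma depthGE_graphUpperSet_card {ι : Type} [LinearOrder ι] [Fintype ι] {E : ι → ι → Prop}
    (hle : ∀ p q, E p q → p ≤ q) (htrans : ∀ p q r, E p q → E q r → E p r) (X Y : Finset ι)
    (h : ∀ p ∉ X, p ∈ Y → ∀ q, E p q → q ∈ Y) : DepthGE k (graphUpperSet X Y E) Xᶜ.card := by
  classical
  generalize hn : Xᶜ.card = n
  induction n generalizing X Y with
  | zero => exact DepthGE.zero
  | succ n ih =>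
    have hne : Xᶜ.Nonempty := Finset.card_pos.1 (by omega)
    obtain ⟨p, hp, hmin⟩ := Finset.exists_min_image Xᶜ id hne
    simp only [Finset.mem_compl, id] at hp hmin
    have hn' := card_compl_insert hp hn
    by_cases hpY : p ∈ Y
    · exact (depthGE_graphUpperSet_insert_left hp (h p hp hpY) n).2 (ih _ _ (by grind) hn')
    · refine DepthGE.of_colon (e := Finsupp.single (.inl p) 1)
        (C := graphUpperSet X (Y ∪ Finset.univ.filter (E p)) E)
        (A := graphUpperSet (insert p X) Y E)
        (fun s ↦ mem_graphUpperSet_colon hp (by simp))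
        (fun s ↦ mem_graphUpperSet_insert_left) ?_ ?_
      · refine (depthGE_graphUpperSet_insert_left hp (by simp +contextual) n).2 (ih _ _ ?_ hn')
        simp only [Finset.mem_insert, Finset.mem_union, Finset.mem_filter, Finset.mem_univ]
        grind
      · exact (depthGE_graphUpperSet_insert_right hpY (by grind) n).2 (ih _ _ (by grind) hn')

lemma not_depthGE_graphUpperSet_univ (X : Finset ι) :
    ¬ DepthGE k (graphUpperSet X Finset.univ E) (Xᶜ.card + 1) := by
  generalize hn : Xᶜ.card = n
  induction n generalizing X with
  | zero =>
    refine not_depthGE_one fun s ↦ ?_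
    obtain rfl : X = Finset.univ := by simpa using hn
    rw [mem_graphUpperSet, Finsupp.ne_iff, Sum.exists]
    simp
    grind
  | succ n ih =>
    obtain ⟨p, hp⟩ : Xᶜ.Nonempty := Finset.card_pos.1 (by omega)
    rw [Finset.mem_compl] at hp
    rw [depthGE_graphUpperSet_insert_left hp (by simp)]
    exact ih _ (card_compl_insert hp hn)

end

section

variable {k : Type} [Field k] {ι : Type} [LinearOrder ι]

/-- The pairs `p ≤ q` of elements of `F`. -/
def BlockEdge (F : Finset ι) (p q : ι) : Prop := p ∈ F ∧ q ∈ F ∧ p ≤ q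

/-- The exponent of the monomial `x_p y_q`. -/
noncomputable def edgeExp (p q : ι) : ι ⊕ ι →₀ ℕ :=
  Finsupp.single (.inl p) 1 + Finsupp.single (.inr q) 1

lemma edgeExp_apply_inl (p q r : ι) : edgeExp p q (.inl r) = if r = p then 1 else 0 := by
  simp [edgeExp, Finsupp.single_apply, eq_comm]

lemma edgeExp_apply_inr (p q r : ι) : edgeExp p q (.inr r) = if r = q then 1 else 0 := by
  simp [edgeExp, Finsupp.single_apply, eq_comm]

lemma edgeExp_le_iff {p q : ι} {s : ι ⊕ ι →₀ ℕ} :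
    edgeExp p q ≤ s ↔ s (.inl p) ≠ 0 ∧ s (.inr q) ≠ 0 := by
  rw [Finsupp.le_def, Sum.forall]
  simp only [edgeExp_apply_inl, edgeExp_apply_inr]
  grind

lemma edgeExp_add_edgeExp_le_iff {p q p' q' : ι} {s : ι ⊕ ι →₀ ℕ} :
    edgeExp p q + edgeExp p' q' ≤ s ↔
      (s (.inl p) ≠ 0 ∧ s (.inl p') ≠ 0 ∧ (p = p' → 2 ≤ s (.inl p))) ∧
      (s (.inr q) ≠ 0 ∧ s (.inr q') ≠ 0 ∧ (q = q' → 2 ≤ s (.inr q))) := by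
  rw [Finsupp.le_def, Sum.forall]
  simp only [Finsupp.add_apply, edgeExp_apply_inl, edgeExp_apply_inr]
  refine and_congr ⟨fun h ↦ ?_, fun h r ↦ ?_⟩ ⟨fun h ↦ ?_, fun h r ↦ ?_⟩
  · have := h p
    have := h p'
    grind
  · grind
  · have := h q
    have := h q'
    grind
  · grind

/-- The exponents of the monomials in the product of the edge ideals of two blocks. -/
noncomputable def blockProd (F G : Finset ι) : UpperSet (ι ⊕ ι →₀ ℕ) where
  carrier := {s | ∃ p q p' q', BlockEdge F p q ∧ BlockEdge G p' q' ∧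
    edgeExp p q + edgeExp p' q' ≤ s}
  upper' := fun _ _ hst ⟨p, q, p', q', h, h', hs⟩ ↦ ⟨p, q, p', q', h, h', hs.trans hst⟩

lemma mem_blockProd {F G : Finset ι} {s : ι ⊕ ι →₀ ℕ} :
    s ∈ blockProd F G ↔ ∃ p q p' q', BlockEdge F p q ∧ BlockEdge G p' q' ∧
      edgeExp p q + edgeExp p' q' ≤ s :=
  Iff.rfl

/-- The exponents of the monomials in `(x_z, y_z) + J_F² + J_F J_G + H + (x_p y_q : (p, q) ∈ P)`,
where `J_F` and `J_G` are the edge ideals of the blocks `F` and `G`. -/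
noncomputable def stageUpperSet (z : ι) (F G : Finset ι) (H : UpperSet (ι ⊕ ι →₀ ℕ))
    (P : Finset (ι × ι)) : UpperSet (ι ⊕ ι →₀ ℕ) :=
  graphUpperSet {z} {z} (fun p q ↦ (p, q) ∈ P) ⊓ blockProd F F ⊓ blockProd F G ⊓ H

lemma mem_stageUpperSet {z : ι} {F G : Finset ι} {H : UpperSet (ι ⊕ ι →₀ ℕ)}
    {P : Finset (ι × ι)} {s : ι ⊕ ι →₀ ℕ} :
    s ∈ stageUpperSet z F G H P ↔ s (.inl z) ≠ 0 ∨ s (.inr z) ≠ 0 ∨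
      (∃ p q, (p, q) ∈ P ∧ s (.inl p) ≠ 0 ∧ s (.inr q) ≠ 0) ∨
      s ∈ blockProd F F ∨ s ∈ blockProd F G ∨ s ∈ H := by
  simp only [stageUpperSet, UpperSet.mem_inf_iff, mem_graphUpperSet, Finset.mem_singleton,
    exists_eq_left, or_assoc]

/-- Set-up for the colon computations: `z`, `F`, `G` are disjoint, and dividing an element of `H`
by an edge of `F` leaves a multiple of an edge of `G`. -/
structure BlockData (z : ι) (F G : Finset ι) (H : UpperSet (ι ⊕ ι →₀ ℕ)) : Prop where
  notMem_left : z ∉ F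
  notMem_right : z ∉ G
  disj : ∀ i ∈ F, i ∉ G
  colon : ∀ p q s, BlockEdge F p q → s + edgeExp p q ∈ H →
    ∃ p' q', BlockEdge G p' q' ∧ s (.inl p') ≠ 0 ∧ s (.inr q') ≠ 0

/-- The edge `(a, b)` precedes the edge `(p, q)` in the filtration. -/
def EdgePrec (a b p q : ι) : Prop := a < p ∨ a = p ∧ q < b

section

variable {z : ι} {F G : Finset ι} {H : UpperSet (ι ⊕ ι →₀ ℕ)} {P : Finset (ι × ι)}
  {p q : ι}

/-- `P` is the set of edges of `F` preceding `(p, q)`. -/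
structure IsCut (F : Finset ι) (P : Finset (ι × ι)) (p q : ι) : Prop where
  edge : BlockEdge F p q
  mem_iff : ∀ a b, (a, b) ∈ P ↔ BlockEdge F a b ∧ EdgePrec a b p q

lemma add_edgeExp_inl_ne_zero {s : ι ⊕ ι →₀ ℕ} {r : ι} :
    (s + edgeExp p q : ι ⊕ ι →₀ ℕ) (.inl r) ≠ 0 ↔ s (.inl r) ≠ 0 ∨ r = p := by
  rw [Finsupp.add_apply, edgeExp_apply_inl]
  grind

lemma add_edgeExp_inr_ne_zero {s : ι ⊕ ι →₀ ℕ} {r : ι} :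
    (s + edgeExp p q : ι ⊕ ι →₀ ℕ) (.inr r) ≠ 0 ↔ s (.inr r) ≠ 0 ∨ r = q := by
  rw [Finsupp.add_apply, edgeExp_apply_inr]
  grind

lemma add_edgeExp_mem_stageUpperSet (hd : BlockData z F G H) (hP : IsCut F P p q)
    {s : ι ⊕ ι →₀ ℕ} :
    s + edgeExp p q ∈ stageUpperSet z F G H P ↔
      ((s (.inl z) ≠ 0 ∨ s (.inr z) ≠ 0 ∨ (∃ r ∈ F, r < p ∧ s (.inl r) ≠ 0) ∨
        (∃ t ∈ F, q < t ∧ s (.inr t) ≠ 0) ∨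
        ∃ p' q', BlockEdge G p' q' ∧ s (.inl p') ≠ 0 ∧ s (.inr q') ≠ 0) ∨
      ((∃ r ∈ F, p ≤ r ∧ r ≤ q ∧ s (.inl r) ≠ 0) ∧
        ∃ t ∈ F, p ≤ t ∧ t ≤ q ∧ s (.inr t) ≠ 0)) := by
  obtain ⟨hpF, hqF, hpq⟩ := hP.edge
  have hzp : z ≠ p := by rintro rfl; exact hd.notMem_left hpF
  have hzq : z ≠ q := by rintro rfl; exact hd.notMem_left hqF
  rw [mem_stageUpperSet]
  simp only [add_edgeExp_inl_ne_zero, add_edgeExp_inr_ne_zero, hzp, hzq, or_false]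
  constructor
  · rintro (h | h | ⟨a, b, hab, ha, hb⟩ | ⟨a, b, c, d, ⟨haF, hbF, hab⟩, ⟨hcF, hdF, hcd⟩, h⟩ |
      ⟨a, b, c, d, hab, hcd, h⟩ | h)
    · exact .inl (.inl h)
    · exact .inl (.inr (.inl h))
    · obtain ⟨⟨haF, hbF, hab⟩, h | ⟨rfl, h⟩⟩ := (hP.mem_iff _ _).1 hab
      · exact .inl (.inr (.inr (.inl ⟨a, haF, h, ha.resolve_right h.ne⟩)))
      · exact .inl (.inr (.inr (.inr (.inl ⟨b, hbF, h, hb.resolve_right h.ne'⟩))))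
    · simp only [edgeExp_add_edgeExp_le_iff, add_edgeExp_inl_ne_zero, add_edgeExp_inr_ne_zero] at h
      simp only [Finsupp.add_apply, edgeExp_apply_inl, edgeExp_apply_inr] at h
      have hx : s (.inl a) ≠ 0 ∨ s (.inl c) ≠ 0 := by grind
      have hy : s (.inr b) ≠ 0 ∨ s (.inr d) ≠ 0 := by grind
      obtain ⟨⟨ha, hc, -⟩, hb, hd, -⟩ := h
      by_contra! hcon
      obtain ⟨⟨-, -, h1, h2, -⟩, h3⟩ := hcon
      have ha' := h1 a haF
      have hc' := h1 c hcF
      have hb' := h2 b hbF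
      have hd' := h2 d hdF
      have ha3 := fun u v w ↦ h3 ⟨a, haF, u, v, w⟩
      have hc3 := fun u v w ↦ h3 ⟨c, hcF, u, v, w⟩
      have hb3 := fun w ↦ (h3 w b hbF)
      have hd3 := fun w ↦ (h3 w d hdF)
      clear h1 h2 h3
      grind
    · rw [edgeExp_add_edgeExp_le_iff] at h
      simp only [add_edgeExp_inl_ne_zero, add_edgeExp_inr_ne_zero] at h
      refine .inl (.inr (.inr (.inr (.inr ⟨c, d, hcd, h.1.2.1.resolve_right ?_,
        h.2.2.1.resolve_right ?_⟩))))
      · rintro rfl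
        exact hd.disj _ hpF hcd.1
      · rintro rfl
        exact hd.disj _ hqF hcd.2.1
    · exact .inl (.inr (.inr (.inr (.inr (hd.colon p q s hP.edge h)))))
  · rintro ((h | h | ⟨r, hrF, hr, h⟩ | ⟨t, htF, ht, h⟩ | ⟨p', q', h, h1, h2⟩) |
      ⟨⟨r, hrF, hpr, hrq, hr⟩, t, htF, hpt, htq, ht⟩)
    · exact .inl h
    · exact .inr (.inl h)
    · exact .inr (.inr (.inl ⟨r, q, (hP.mem_iff _ _).2 ⟨⟨hrF, hqF, hr.le.trans hpq⟩, .inl hr⟩,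
        .inl h, .inr rfl⟩))
    · exact .inr (.inr (.inl ⟨p, t, (hP.mem_iff _ _).2 ⟨⟨hpF, htF, hpq.trans ht.le⟩,
        .inr ⟨rfl, ht⟩⟩, .inr rfl, .inl h⟩))
    · refine .inr (.inr (.inr (.inr (.inl ⟨p, q, p', q', hP.edge, h, ?_⟩))))
      rw [add_comm]
      exact add_le_add_left (edgeExp_le_iff.2 ⟨h1, h2⟩) _
    · refine .inr (.inr (.inr (.inl ⟨p, t, r, q, ⟨hpF, htF, hpt⟩, ⟨hrF, hqF, hrq⟩, ?_⟩)))
      calc edgeExp p t + edgeExp r q = edgeExp r t + edgeExp p q := by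
            simp only [edgeExp]; abel
        _ ≤ _ := add_le_add_left (edgeExp_le_iff.2 ⟨hr, ht⟩) _

end

end

section

variable {k : Type} [Field k] {ι : Type} [LinearOrder ι] {z : ι} {F G : Finset ι}
  {H : UpperSet (ι ⊕ ι →₀ ℕ)} {P : Finset (ι × ι)} {p q : ι} {t : ℕ}

variable (z F G p q) in
/-- The first component of the colon ideal. -/
def colonLeft : UpperSet (ι ⊕ ι →₀ ℕ) :=
  graphUpperSet (insert z (F.filter (· ≤ q))) (insert z (F.filter (q < ·))) (BlockEdge G)

variable (z F G p q) in
/-- The second component of the colon ideal. -/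
def colonRight : UpperSet (ι ⊕ ι →₀ ℕ) :=
  graphUpperSet (insert z (F.filter (· < p))) (insert z (F.filter (p ≤ ·))) (BlockEdge G)

variable (z F G p q) in
/-- The sum of the two components of the colon ideal. -/
def colonSup : UpperSet (ι ⊕ ι →₀ ℕ) :=
  graphUpperSet (insert z (F.filter (· ≤ q))) (insert z (F.filter (p ≤ ·))) (BlockEdge G)

lemma mem_colonLeft_sup_colonRight (hd : BlockData z F G H) (hP : IsCut F P p q)
    (s : ι ⊕ ι →₀ ℕ) :
    s ∈ colonLeft z F G q ⊔ colonRight z F G p ↔ s + edgeExp p q ∈ stageUpperSet z F G H P := by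
  have hpq := hP.edge.2.2
  rw [add_edgeExp_mem_stageUpperSet hd hP, UpperSet.mem_sup_iff, colonLeft, colonRight,
    mem_graphUpperSet, mem_graphUpperSet]
  simp only [Finset.mem_insert, Finset.mem_filter]
  grind

lemma mem_colonSup (hpq : p ≤ q) (s : ι ⊕ ι →₀ ℕ) :
    s ∈ colonSup z F G p q ↔ s ∈ colonLeft z F G q ∨ s ∈ colonRight z F G p := by
  simp only [colonLeft, colonRight, colonSup, mem_graphUpperSet, Finset.mem_insert,
    Finset.mem_filter]
  grind

lemma mem_stageUpperSet_insert {s : ι ⊕ ι →₀ ℕ} :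
    s ∈ stageUpperSet z F G H (insert (p, q) P) ↔
      s ∈ stageUpperSet z F G H P ∨ edgeExp p q ≤ s := by
  simp only [mem_stageUpperSet, edgeExp_le_iff, Finset.mem_insert, Prod.mk.injEq,
    or_and_right, exists_or, and_assoc, exists_and_left, exists_eq_left]
  grind

variable [Fintype ι]

lemma depthGE_graphUpperSet_blockEdge {X Y T : Finset ι} (hX : ∀ r ∈ T, r ∉ X)
    (hY : ∀ r ∈ Y, r ∉ G) : DepthGE k (graphUpperSet X Y (BlockEdge G)) T.card := by
  refine (depthGE_graphUpperSet_card ?_ ?_ _ _ ?_).mono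
    (Finset.card_le_card fun r hr ↦ Finset.mem_compl.2 (hX r hr))
  · exact fun p q h ↦ h.2.2
  · exact fun p q r h h' ↦ ⟨h.1, h'.2.1, h.2.2.trans h'.2.2⟩
  · exact fun p _ hp q h ↦ absurd h.1 (hY p hp)

lemma depthGE_colonLeft (hd : BlockData z F G H) (h : BlockEdge F p q) :
    DepthGE k (colonLeft z F G q) (G.card + 1) := by
  obtain ⟨hp, hq, hpq⟩ := h
  have h1 := hd.notMem_left
  have h2 := hd.notMem_right
  have h3 := hd.disj
  refine (depthGE_graphUpperSet_insert_right (q := p) ?_ ?_ _).2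
    (depthGE_graphUpperSet_blockEdge ?_ ?_)
  · grind
  · exact fun r hr ↦ absurd hr.2.1 (h3 p hp)
  · grind
  · grind

lemma depthGE_colonRight (hd : BlockData z F G H) (hp : p ∈ F) :
    DepthGE k (colonRight z F G p) (G.card + 1) := by
  have h1 := hd.notMem_left
  have h2 := hd.notMem_right
  have h3 := hd.disj
  rw [← Finset.card_insert_of_notMem (h3 p hp)]
  refine depthGE_graphUpperSet_blockEdge ?_ ?_
  · grind
  · grind

lemma depthGE_colonSup (hd : BlockData z F G H) : DepthGE k (colonSup z F G p q) G.card := by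
  have h2 := hd.notMem_right
  have h3 := hd.disj
  refine depthGE_graphUpperSet_blockEdge ?_ ?_
  · grind
  · grind

lemma depthGE_colon (hd : BlockData z F G H) (h : BlockEdge F p q) :
    DepthGE k (colonLeft z F G q ⊔ colonRight z F G p) (G.card + 1) :=
  DepthGE.inf (fun _ ↦ UpperSet.mem_sup_iff) (mem_colonSup h.2.2) (depthGE_colonLeft hd h)
    (depthGE_colonRight hd h.1) (depthGE_colonSup hd)

open Classical in
lemma depthGE_stageUpperSet (hd : BlockData z F G H) (ht : t ≤ G.card + 1)
    (hfull : DepthGE k (stageUpperSet z F G H (Finset.univ.filter fun e ↦ BlockEdge F e.1 e.2)) t)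
    (hPF : ∀ a b, (a, b) ∈ P → BlockEdge F a b)
    (hP : ∀ a b c d, (c, d) ∈ P → BlockEdge F a b → EdgePrec a b c d → (a, b) ∈ P) :
    DepthGE k (stageUpperSet z F G H P) t := by
  generalize hn : ((Finset.univ.filter fun e : ι × ι ↦ BlockEdge F e.1 e.2) \ P).card = n
  induction n generalizing P with
  | zero =>
    convert hfull
    ext ⟨a, b⟩
    rw [Finset.card_eq_zero, Finset.sdiff_eq_empty_iff_subset] at hn
    exact ⟨fun h ↦ by simpa using hPF a b h, fun h ↦ hn h⟩
  | succ n ih =>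
    obtain ⟨⟨p, q⟩, hpq, hmin⟩ := Finset.exists_min_image _
      (fun e : ι × ι ↦ (toLex (e.1, OrderDual.toDual e.2) : ι ×ₗ ιᵒᵈ))
      (Finset.card_pos.1 (n.succ_pos.trans_eq hn.symm))
    simp only [Finset.mem_sdiff, Finset.mem_filter, Finset.mem_univ, true_and, Prod.forall,
      Prod.Lex.toLex_le_toLex, OrderDual.toDual_le_toDual] at hpq hmin
    have hcut : IsCut F P p q := by
      refine ⟨hpq.1, fun a b ↦ ⟨fun h ↦ ⟨hPF a b h, ?_⟩, fun ⟨h, h'⟩ ↦ ?_⟩⟩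
      · by_contra hlt
        apply hpq.2
        by_cases heq : a = p ∧ b = q
        · rwa [heq.1, heq.2] at h
        · refine hP _ _ _ _ h hpq.1 ?_
          unfold EdgePrec at *
          grind
      · by_contra hmem
        have := hmin a b ⟨h, hmem⟩
        unfold EdgePrec at h'
        grind
    refine DepthGE.of_colon (mem_colonLeft_sup_colonRight hd hcut)
      (fun s ↦ mem_stageUpperSet_insert) ((depthGE_colon hd hpq.1).mono ht) (ih ?_ ?_ ?_)
    · grind
    · intro a b c d hcd hab hprec
      rw [Finset.mem_insert, Prod.mk.injEq] at hcd
      obtain ⟨rfl, rfl⟩ | hcd := hcd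
      · exact Finset.mem_insert_of_mem ((hcut.mem_iff _ _).2 ⟨hab, hprec⟩)
      · exact Finset.mem_insert_of_mem (hP _ _ _ _ hcd hab hprec)
    · rw [Finset.sdiff_insert, Finset.card_erase_of_mem, hn]
      · rfl
      · simpa using hpq

end

section

variable {k : Type} [Field k] {ι : Type} [LinearOrder ι] {z : ι} {F G : Finset ι}

lemma blockProd_comm (F G : Finset ι) : blockProd F G = blockProd G F := by
  ext s
  rw [SetLike.mem_coe, SetLike.mem_coe, mem_blockProd, mem_blockProd]
  constructor <;>
  · rintro ⟨p, q, p', q', h, h', hs⟩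
    exact ⟨p', q', p, q, h', h, by rwa [add_comm]⟩

lemma exists_blockEdge_of_mem_blockProd {s : ι ⊕ ι →₀ ℕ} (hs : s ∈ blockProd F G) :
    ∃ p q, BlockEdge F p q ∧ s (.inl p) ≠ 0 ∧ s (.inr q) ≠ 0 := by
  obtain ⟨p, q, p', q', h, h', hs⟩ := hs
  exact ⟨p, q, h, edgeExp_le_iff.1 (le_self_add.trans hs)⟩

lemma blockData_blockProd (hF : z ∉ F) (hG : z ∉ G) (hFG : ∀ i ∈ F, i ∉ G) :
    BlockData z F G (blockProd G G) := by
  refine ⟨hF, hG, hFG, fun p q s h hs ↦ ?_⟩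
  obtain ⟨a, b, hab, ha, hb⟩ := exists_blockEdge_of_mem_blockProd hs
  rw [add_edgeExp_inl_ne_zero] at ha
  rw [add_edgeExp_inr_ne_zero] at hb
  exact ⟨a, b, hab, ha.resolve_right fun h' ↦ hFG _ h.1 (h' ▸ hab.1),
    hb.resolve_right fun h' ↦ hFG _ h.2.1 (h' ▸ hab.2.1)⟩

lemma blockData_graphUpperSet (hF : z ∉ F) (hG : z ∉ G) (hFG : ∀ i ∈ F, i ∉ G) :
    BlockData z G F (graphUpperSet ∅ ∅ (BlockEdge F)) := by
  refine ⟨hG, hF, fun i h h' ↦ hFG i h' h, fun p q s h hs ↦ ?_⟩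
  simp only [mem_graphUpperSet, Finset.notMem_empty, false_and, exists_false, false_or,
    add_edgeExp_inl_ne_zero, add_edgeExp_inr_ne_zero] at hs
  obtain ⟨a, b, hab, ha, hb⟩ := hs
  exact ⟨a, b, hab, ha.resolve_right fun h' ↦ hFG _ hab.1 (h' ▸ h.1),
    hb.resolve_right fun h' ↦ hFG _ hab.2.1 (h' ▸ h.2.1)⟩

variable [Fintype ι]

open Classical in
lemma stageUpperSet_edges_left :
    stageUpperSet z F G (blockProd G G) (Finset.univ.filter fun e ↦ BlockEdge F e.1 e.2) =
      stageUpperSet z G F (graphUpperSet ∅ ∅ (BlockEdge F)) ∅ := by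
  ext s
  have := exists_blockEdge_of_mem_blockProd (s := s) (F := F) (G := F)
  simp only [SetLike.mem_coe, mem_stageUpperSet, mem_graphUpperSet, Finset.notMem_empty, false_and,
    exists_false, false_or, Finset.mem_filter, Finset.mem_univ, true_and, blockProd_comm G F]
  grind

open Classical in
lemma stageUpperSet_edges_right :
    stageUpperSet z G F (graphUpperSet ∅ ∅ (BlockEdge F))
        (Finset.univ.filter fun e ↦ BlockEdge G e.1 e.2) =
      graphUpperSet {z} {z} (fun p q ↦ BlockEdge F p q ∨ BlockEdge G p q) := by
  ext s
  have h1 := exists_blockEdge_of_mem_blockProd (s := s) (F := G) (G := G)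
  have h2 := exists_blockEdge_of_mem_blockProd (s := s) (F := G) (G := F)
  simp only [SetLike.mem_coe, mem_stageUpperSet, mem_graphUpperSet, Finset.notMem_empty, false_and,
    exists_false, false_or, Finset.mem_filter, Finset.mem_univ, true_and, Finset.mem_singleton,
    exists_eq_left, or_and_right, exists_or]
  grind

open Classical in
lemma depthGE_stageUpperSet_edges (hF : z ∉ F) (hG : z ∉ G) (hFG : ∀ i ∈ F, i ∉ G)
    (hne : F.Nonempty) (hcard : G.card ≤ F.card) :
    DepthGE k (stageUpperSet z F G (blockProd G G)
      (Finset.univ.filter fun e ↦ BlockEdge F e.1 e.2)) (G.card + 1) := by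
  rw [stageUpperSet_edges_left]
  refine depthGE_stageUpperSet (blockData_graphUpperSet hF hG hFG) (by omega) ?_
    (by simp) (by simp)
  rw [stageUpperSet_edges_right]
  have hle : G.card + 1 ≤ ({z} : Finset ι)ᶜ.card := by
    have : (F ∪ G).card ≤ ({z} : Finset ι)ᶜ.card := Finset.card_le_card (by
      intro i hi
      rw [Finset.mem_compl, Finset.mem_singleton]
      rintro rfl
      simp_all)
    rw [Finset.card_union_of_disjoint (Finset.disjoint_left.2 hFG)] at this
    have := hne.card_pos
    omega
  refine (depthGE_graphUpperSet_card ?_ ?_ _ _ ?_).mono hle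
  · exact fun p q h ↦ h.elim (·.2.2) (·.2.2)
  · rintro p q r (h | h) (h' | h')
    · exact .inl ⟨h.1, h'.2.1, h.2.2.trans h'.2.2⟩
    · exact absurd h'.1 (hFG _ h.2.1)
    · exact absurd h.2.1 (hFG _ h'.1)
    · exact .inr ⟨h.1, h'.2.1, h.2.2.trans h'.2.2⟩
  · exact fun p hp hp' ↦ absurd hp' hp

lemma depthGE_stageUpperSet_empty (hF : z ∉ F) (hG : z ∉ G) (hFG : ∀ i ∈ F, i ∉ G)
    (hne : F.Nonempty) (hcard : G.card ≤ F.card) :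
    DepthGE k (stageUpperSet z F G (blockProd G G) ∅) (G.card + 1) :=
  depthGE_stageUpperSet (blockData_blockProd hF hG hFG) le_rfl
    (depthGE_stageUpperSet_edges hF hG hFG hne hcard) (by simp) (by simp)

lemma not_depthGE_graphUpperSet_blockEdge (hne : G.Nonempty) :
    ¬ DepthGE k (graphUpperSet Gᶜ Gᶜ (BlockEdge G)) (G.card + 1) := by
  classical
  intro h
  have hc := G.min'_mem hne
  have hmin : ∀ r ∈ G, G.min' hne ≤ r := fun r hr ↦ G.min'_le r hr
  generalize G.min' hne = c at hc hmin
  obtain ⟨n, hn⟩ := Nat.exists_eq_add_of_lt hne.card_pos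
  rw [zero_add] at hn
  have hcX : c ∉ Gᶜ := by simpa using hc
  have hZ (q : ι) : q ∈ G ↔ BlockEdge G c q := ⟨fun h ↦ ⟨hc, h, hmin q h⟩, fun h ↦ h.2.1⟩
  refine not_depthGE_graphUpperSet_univ (k := k) (E := BlockEdge G) Gᶜ ?_
  rw [compl_compl]
  have hun : Gᶜ ∪ G = Finset.univ := by rw [Finset.union_comm, Finset.union_compl]
  rw [← hun]
  refine DepthGE.colon (e := Finsupp.single (.inl c) 1) (fun s ↦ mem_graphUpperSet_colon hcX hZ)
    (fun s ↦ mem_graphUpperSet_insert_left) h ?_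
  rw [hn]
  refine (depthGE_graphUpperSet_insert_right (q := c) hcX ?_ _).2 ?_
  · intro p hp
    have := hmin p hp.1
    simp [le_antisymm hp.2.2 this]
  · have hn' : (insert c Gᶜ)ᶜ.card = n := card_compl_insert hcX (by rw [compl_compl, hn])
    rw [← hn']
    refine depthGE_graphUpperSet_card (fun _ _ h ↦ h.2.2)
      (fun p q r h h' ↦ ⟨h.1, h'.2.1, h.2.2.trans h'.2.2⟩) _ _ ?_
    exact fun p hp hp' ↦ absurd hp' hp

lemma not_depthGE_stageUpperSet_empty (hF : z ∉ F) (hG : z ∉ G) (hFG : ∀ i ∈ F, i ∉ G)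
    (hcover : ∀ i, i = z ∨ i ∈ F ∨ i ∈ G)
    (hneG : G.Nonempty) (hcard : G.card ≤ F.card) :
    ¬ DepthGE k (stageUpperSet z F G (blockProd G G) ∅) (G.card + 2) := by
  intro h
  have hne : F.Nonempty := Finset.card_pos.1 (hneG.card_pos.trans_le hcard)
  have hd := blockData_blockProd hF hG hFG
  have hpF := F.min'_mem hne
  have hqF := F.max'_mem hne
  have hp : ∀ r ∈ F, F.min' hne ≤ r := fun r hr ↦ F.min'_le r hr
  have hq : ∀ r ∈ F, r ≤ F.max' hne := fun r hr ↦ F.le_max' r hr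
  generalize F.min' hne = p at hpF hp
  generalize F.max' hne = q at hqF hq
  have hpq : BlockEdge F p q := ⟨hpF, hqF, hp q hqF⟩
  have hprec (a b : ι) (hab : BlockEdge F a b) : ¬ EdgePrec a b p q := by
    rintro (h | ⟨-, h⟩)
    · exact h.not_ge (hp _ hab.1)
    · exact h.not_ge (hq _ hab.2.1)
  have hcut : IsCut F ∅ p q := by
    refine ⟨hpq, fun a b ↦ ?_⟩
    simpa using hprec a b
  have hstage : DepthGE k (stageUpperSet z F G (blockProd G G) (insert (p, q) ∅)) (G.card + 1) := by
    refine depthGE_stageUpperSet hd le_rfl (depthGE_stageUpperSet_edges hF hG hFG hne hcard) ?_ ?_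
    · grind
    · intro a b c d hcd hab habp
      obtain ⟨rfl, rfl⟩ : c = p ∧ d = q := by simpa using hcd
      exact absurd habp (hprec a b hab)
  have hcolon := DepthGE.colon (mem_colonLeft_sup_colonRight hd hcut)
    (fun s ↦ mem_stageUpperSet_insert) h hstage
  have hsup := DepthGE.sup (fun _ ↦ UpperSet.mem_sup_iff) (mem_colonSup hpq.2.2)
    (depthGE_colonLeft hd hpq) (depthGE_colonRight hd hpq.1) hcolon
  apply not_depthGE_graphUpperSet_blockEdge (k := k) hneG
  have hX : Gᶜ = insert z (F.filter (· ≤ q)) := by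
    ext i
    have := hcover i
    simp only [Finset.mem_compl, Finset.mem_insert, Finset.mem_filter]
    grind
  have hY : Gᶜ = insert z (F.filter (p ≤ ·)) := by
    ext i
    have := hcover i
    simp only [Finset.mem_compl, Finset.mem_insert, Finset.mem_filter]
    grind
  rw [colonSup, ← hX, ← hY] at hsup
  exact hsup

omit [Fintype ι]

variable (z F G) in
/-- The exponents of the monomials in `(x_z) + (J_F + J_G)²`, where `J_F` and `J_G` are the edge
ideals of the blocks `F` and `G`. -/
noncomputable def squareUpperSet : UpperSet (ι ⊕ ι →₀ ℕ) :=
  graphUpperSet {z} ∅ (fun _ _ ↦ False) ⊓ blockProd F F ⊓ blockProd F G ⊓ blockProd G G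

lemma mem_squareUpperSet {s : ι ⊕ ι →₀ ℕ} :
    s ∈ squareUpperSet z F G ↔ s (.inl z) ≠ 0 ∨ s ∈ blockProd F F ∨ s ∈ blockProd F G ∨
      s ∈ blockProd G G := by
  simp [squareUpperSet, mem_graphUpperSet, or_assoc]

lemma squareUpperSet_comm : squareUpperSet z F G = squareUpperSet z G F := by
  ext s
  simp only [SetLike.mem_coe, mem_squareUpperSet, blockProd_comm G F]
  tauto

lemma mem_blockProd_of_add_single (hF : z ∉ F) (hG : z ∉ G) {s : ι ⊕ ι →₀ ℕ}
    (hs : s + Finsupp.single (.inr z) 1 ∈ blockProd F G) : s ∈ blockProd F G := by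
  obtain ⟨p, q, p', q', h, h', hs⟩ := hs
  refine ⟨p, q, p', q', h, h', ?_⟩
  have h1 : q ≠ z := fun h0 ↦ hF (h0 ▸ h.2.1)
  have h2 : q' ≠ z := fun h0 ↦ hG (h0 ▸ h'.2.1)
  simpa [edgeExp_add_edgeExp_le_iff, Finsupp.single_apply, h1.symm, h2.symm] using hs

lemma depthGE_squareUpperSet_iff (hF : z ∉ F) (hG : z ∉ G) (t : ℕ) :
    DepthGE k (squareUpperSet z F G) (t + 1) ↔
      DepthGE k (stageUpperSet z F G (blockProd G G) ∅) t := by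
  refine depthGE_succ_iff (v := .inr z) (fun s hs ↦ ?_) (fun s ↦ ?_)
  · rw [mem_squareUpperSet] at hs ⊢
    refine Or.imp ?_ (Or.imp (mem_blockProd_of_add_single hF hF)
      (Or.imp (mem_blockProd_of_add_single hF hG) (mem_blockProd_of_add_single hG hG))) hs
    simp
  · simp only [mem_squareUpperSet, mem_stageUpperSet, Finset.notMem_empty, false_and, exists_false]
    tauto

lemma depthGE_squareUpperSet [Fintype ι] (hF : z ∉ F) (hG : z ∉ G) (hFG : ∀ i ∈ F, i ∉ G)
    (hcover : ∀ i, i = z ∨ i ∈ F ∨ i ∈ G) (hneF : F.Nonempty) (hneG : G.Nonempty) :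
    DepthGE k (squareUpperSet z F G) (min F.card G.card + 2) ∧
      ¬ DepthGE k (squareUpperSet z F G) (min F.card G.card + 3) := by
  obtain hcard | hcard := le_total G.card F.card
  · rw [min_eq_right hcard]
    exact ⟨(depthGE_squareUpperSet_iff hF hG _).2
        (depthGE_stageUpperSet_empty hF hG hFG hneF hcard),
      fun h ↦ not_depthGE_stageUpperSet_empty hF hG hFG hcover hneG hcard
        ((depthGE_squareUpperSet_iff hF hG _).1 h)⟩
  · have hGF : ∀ i ∈ G, i ∉ F := fun i hi h ↦ hFG i h hi
    rw [min_eq_left hcard, squareUpperSet_comm]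
    exact ⟨(depthGE_squareUpperSet_iff hG hF _).2
        (depthGE_stageUpperSet_empty hG hF hGF hneG hcard),
      fun h ↦ not_depthGE_stageUpperSet_empty hG hF hGF
        (fun i ↦ (hcover i).imp_right Or.symm) hneF hcard
        ((depthGE_squareUpperSet_iff hG hF _).1 h)⟩

end

section

lemma depthQuot_monoIdeal {k σ : Type} [Field k] [Finite σ] {U : UpperSet (σ →₀ ℕ)} (hU : 0 ∉ U)
    {D : ℕ} (hD : D ≠ 0) (h : DepthGE k U D) (h' : ¬ DepthGE k U (D + 1)) :
    depthQuot k (monoIdeal k U) = D := by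
  have hle := monoIdeal_le_maxHomIdeal (k := k) hU
  refine localCohomology.sInf_nontrivial_eq _ _ ?_ D hD h ?_
  · rw [lt_top_iff_ne_top]
    intro htop
    have hsub : maxHomIdeal k σ • (⊤ : Submodule (MvPolynomial σ k)
        (MvPolynomial σ k ⧸ monoIdeal k U)) ≤
        Submodule.map (monoIdeal k U).mkQ (maxHomIdeal k σ) := by
      refine Submodule.smul_le.2 fun r hr n _ ↦ ?_
      obtain ⟨x, rfl⟩ := (monoIdeal k U).mkQ_surjective n
      exact ⟨r * x, Ideal.mul_mem_right _ _ hr, by rw [← smul_eq_mul, map_smul]⟩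
    obtain ⟨x, hx, hx1⟩ := hsub (htop.ge (Submodule.mem_top (x := (monoIdeal k U).mkQ 1)))
    have hsub1 : x - 1 ∈ maxHomIdeal k σ := hle ((Submodule.Quotient.eq _).1 hx1)
    refine maxHomIdeal_ne_top (k := k) (σ := σ) ((Ideal.eq_top_iff_one _).2 ?_)
    have := sub_mem hx hsub1
    rwa [sub_sub_cancel] at this
  · by_contra hcon
    rw [not_nontrivial_iff_subsingleton] at hcon
    refine h' fun i hi ↦ ?_
    obtain hi | rfl := Nat.lt_succ_iff_lt_or_eq.1 hi
    · exact h i hi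
    · exact hcon

lemma X_inl_mul_X_inr {k ι : Type} [Field k] (p q : ι) :
    (X (.inl p) * X (.inr q) : MvPolynomial (ι ⊕ ι) k) = monomial (edgeExp p q) 1 := by
  rw [X, X, monomial_mul, one_mul, edgeExp]

variable {k : Type} [Field k] {ι : Type} [LinearOrder ι] {z : ι} {F G : Finset ι}

lemma span_sq_sup_span_eq_monoIdeal :
    Ideal.span {f : MvPolynomial (ι ⊕ ι) k | ∃ p q, (p = z ∨ BlockEdge F p q ∨ BlockEdge G p q) ∧
      f = X (.inl p) * X (.inr q)} ^ 2 ⊔ Ideal.span {X (.inl z)} =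
    monoIdeal k (squareUpperSet z F G) := by
  apply le_antisymm
  · refine sup_le ?_ ?_
    · rw [pow_two, Ideal.span_mul_span', Ideal.span_le]
      rintro _ ⟨_, ⟨p, q, h, rfl⟩, _, ⟨p', q', h', rfl⟩, rfl⟩
      simp only [SetLike.mem_coe, X_inl_mul_X_inr, monomial_mul, one_mul]
      rw [monomial_mem_monoIdeal, mem_squareUpperSet]
      have hz {p q : ι} (h : p = z) : edgeExp p q (.inl z) ≠ 0 := by
        simp [edgeExp_apply_inl, h]
      obtain h | h | h := h
      · exact .inl (by simp [hz h])
      all_goals obtain h' | h' | h' := h'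
      · exact .inl (by simp [hz h'])
      · exact .inr (.inl ⟨p, q, p', q', h, h', le_rfl⟩)
      · exact .inr (.inr (.inl ⟨p, q, p', q', h, h', le_rfl⟩))
      · exact .inl (by simp [hz h'])
      · exact .inr (.inr (.inl ⟨p', q', p, q, h', h, (add_comm _ _).le⟩))
      · exact .inr (.inr (.inr ⟨p, q, p', q', h, h', le_rfl⟩))
    · rw [Ideal.span_singleton_le_iff_mem, X, monomial_mem_monoIdeal, mem_squareUpperSet]
      exact .inl (by simp)
  · refine Ideal.span_le.2 ?_
    rintro _ ⟨s, hs, rfl⟩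
    have hprod {A B : Finset ι} (hA : A = F ∨ A = G) (hB : B = F ∨ B = G)
        (h : s ∈ blockProd A B) :
        monomial s (1 : k) ∈ Ideal.span {f : MvPolynomial (ι ⊕ ι) k | ∃ p q,
          (p = z ∨ BlockEdge F p q ∨ BlockEdge G p q) ∧ f = X (.inl p) * X (.inr q)} ^ 2 := by
      obtain ⟨p, q, p', q', h, h', hle⟩ := h
      refine Ideal.mem_of_dvd _ (monomial_dvd_monomial_of_le hle) ?_
      have hm : monomial (edgeExp p q + edgeExp p' q') (1 : k) =
          (X (.inl p) * X (.inr q)) * (X (.inl p') * X (.inr q')) := by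
        rw [X_inl_mul_X_inr, X_inl_mul_X_inr, monomial_mul, one_mul]
      rw [hm, pow_two]
      refine Ideal.mul_mem_mul (Ideal.subset_span ⟨p, q, .inr ?_, rfl⟩)
        (Ideal.subset_span ⟨p', q', .inr ?_, rfl⟩)
      · rcases hA with rfl | rfl
        exacts [.inl h, .inr h]
      · rcases hB with rfl | rfl
        exacts [.inl h', .inr h']
    obtain h | h | h | h := mem_squareUpperSet.1 hs
    · refine Ideal.mem_sup_right (Ideal.mem_span_singleton.2 (monomial_dvd_monomial_of_le ?_))
      simpa [Nat.one_le_iff_ne_zero] using h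
    · exact Ideal.mem_sup_left (hprod (.inl rfl) (.inl rfl) h)
    · exact Ideal.mem_sup_left (hprod (.inl rfl) (.inr rfl) h)
    · exact Ideal.mem_sup_left (hprod (.inr rfl) (.inr rfl) h)

lemma zero_notMem_squareUpperSet : 0 ∉ squareUpperSet z F G := by
  have h (A B : Finset ι) : 0 ∉ blockProd A B := fun h ↦ by
    obtain ⟨p, q, -, h, -⟩ := exists_blockEdge_of_mem_blockProd h
    exact h rfl
  rw [mem_squareUpperSet]
  simp [h]

end

end MvPolynomial

/-- Here the ideal `I` is the edge ideal
`I(G_{d,a}) = x_1(y_1, …, y_d) + (x_i y_j : 2 ≤ i ≤ j ≤ a) + (x_i y_j : a+1 ≤ i ≤ j ≤ d)`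
of the bipartite graph `G_{d,a}`, with `x_i = X (inl i)`, `y_i = X (inr i)` and `1`-based
indices translated to `0`-based `Fin d` indices.
Then `depth S/(I(G_{d,a})^2 + (x_1)) = 1 + min (a, d - a + 1)`. -/
theorem depth_square_plus_x1_two_drops_graph (k : Type) [Field k] (d a : ℕ)
    (hd : 5 ≤ d) (ha2 : 2 ≤ a) (had : a ≤ d - 1)
    (I : Ideal (MvPolynomial (Fin d ⊕ Fin d) k))
    (hI : I = Ideal.span
      ({p | ∃ i : Fin d, p = X (Sum.inl (⟨0, by omega⟩ : Fin d)) * X (Sum.inr i)} ∪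
       {p | ∃ i jm : Fin d, 1 ≤ (i : ℕ) ∧ i ≤ jm ∧ (jm : ℕ) < a ∧
          p = X (Sum.inl i) * X (Sum.inr jm)} ∪
       {p | ∃ i jm : Fin d, a ≤ (i : ℕ) ∧ i ≤ jm ∧
          p = X (Sum.inl i) * X (Sum.inr jm)})) :
    depthQuot k (I ^ 2 ⊔
        Ideal.span {(X (Sum.inl (⟨0, by omega⟩ : Fin d)) : MvPolynomial (Fin d ⊕ Fin d) k)}) =
      1 + min a (d - a + 1) := by
  have hd0 : 0 < d := by omega
  set z : Fin d := ⟨0, hd0⟩ with hz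
  let F : Finset (Fin d) := Finset.univ.filter fun i ↦ 1 ≤ (i : ℕ) ∧ (i : ℕ) < a
  let G : Finset (Fin d) := Finset.univ.filter fun i ↦ a ≤ (i : ℕ)
  have hF (i : Fin d) : i ∈ F ↔ 1 ≤ (i : ℕ) ∧ (i : ℕ) < a := by simp [F]
  have hG (i : Fin d) : i ∈ G ↔ a ≤ (i : ℕ) := by simp [G]
  have hI' : I = Ideal.span {f : MvPolynomial (Fin d ⊕ Fin d) k | ∃ p q,
      (p = z ∨ BlockEdge F p q ∨ BlockEdge G p q) ∧ f = X (.inl p) * X (.inr q)} := by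
    rw [hI]
    congr 1
    ext f
    simp only [Set.mem_union, Set.mem_ofPred_eq, BlockEdge, hF, hG]
    constructor
    · rintro ((⟨i, rfl⟩ | ⟨i, j, h1, h2, h3, rfl⟩) | ⟨i, j, h1, h2, rfl⟩)
      · exact ⟨z, i, .inl rfl, rfl⟩
      · have := Fin.le_def.1 h2
        exact ⟨i, j, .inr (.inl (by omega)), rfl⟩
      · have := Fin.le_def.1 h2
        exact ⟨i, j, .inr (.inr (by omega)), rfl⟩
    · rintro ⟨p, q, rfl | ⟨h1, h2, h3⟩ | ⟨h1, h2, h3⟩, rfl⟩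
      · exact .inl (.inl ⟨q, rfl⟩)
      · exact .inl (.inr ⟨p, q, h1.1, h3, h2.2, rfl⟩)
      · exact .inr ⟨p, q, h1, h3, rfl⟩
  have hcF : F.card = a - 1 := by
    have : F.map Fin.valEmbedding = Finset.Ico 1 a := by
      ext i
      simp only [Finset.mem_map, hF, Fin.valEmbedding_apply, Finset.mem_Ico]
      exact ⟨by rintro ⟨j, h, rfl⟩; exact h, fun h ↦ ⟨⟨i, by omega⟩, h, rfl⟩⟩
    rw [← Finset.card_map Fin.valEmbedding, this, Nat.card_Ico]
  have hcG : G.card = d - a := by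
    have : G.map Fin.valEmbedding = Finset.Ico a d := by
      ext i
      simp only [Finset.mem_map, hG, Fin.valEmbedding_apply, Finset.mem_Ico]
      exact ⟨by rintro ⟨j, h, rfl⟩; exact ⟨h, j.2⟩, fun h ↦ ⟨⟨i, h.2⟩, h.1, rfl⟩⟩
    rw [← Finset.card_map Fin.valEmbedding, this, Nat.card_Ico]
  have hdepth := depthGE_squareUpperSet (k := k) (z := z) (F := F) (G := G)
    (by simp [hF, hz]) (by simp [hG, hz]; omega) (by simp only [hF, hG]; omega)
    (by simp only [hF, hG, hz, Fin.ext_iff]; omega)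
    (Finset.card_pos.1 (by omega)) (Finset.card_pos.1 (by omega))
  have hmin : min F.card G.card + 2 = 1 + min a (d - a + 1) := by
    rw [hcF, hcG]
    omega
  rw [hI', span_sq_sup_span_eq_monoIdeal, ← hmin]
  exact depthQuot_monoIdeal zero_notMem_squareUpperSet (by omega) hdepth.1 hdepth.2
end

section
/- Let k be a field, S = k[x_1,…,x_d,y_1,…,y_d], and fix an integer j with 1 ≤ j ≤ d. Let G_{d,j} be the bipartite graph whose edge ideal is I(G_{d,j}) = (x_i y_i : 1 ≤ i ≤ d) + (x_1 y_i : 1 ≤ i ≤ d) + (x_k y_j : 1 ≤ k ≤ j). Then for every integer s with 2 ≤ s ≤ d − j − 2, depth(S/I(G_{d,j})^s) ≤ d − j − s + 3. -/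
open MvPolynomial

section HomologicalAlgebra

open CategoryTheory Limits Opposite

section ExtComparison

variable {R : Type} [CommRing R]

/-- The functor whose left derived functors compute `Ext R (ModuleCat R) n` with values in `Y`. -/
noncomputable abbrev opYoneda (Y : ModuleCat.{0} R) : ModuleCat.{0} R ⥤ (ModuleCat.{0} R)ᵒᵖ :=
  ((linearYoneda R (ModuleCat.{0} R)).obj Y).rightOp

noncomputable abbrev homPoint {X Y : ModuleCat.{0} R} (f : X ⟶ Y) :
    (opYoneda Y).obj X ⟶ op (ModuleCat.of R R) :=
  (ModuleCat.ofHom (LinearMap.toSpanSingleton R (X ⟶ Y) f)).op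

lemma map_comp_homPoint {X X' Y : ModuleCat.{0} R} (g : X' ⟶ X) (f : X ⟶ Y) :
    (opYoneda Y).map g ≫ homPoint f = homPoint (g ≫ f) := by
  apply Quiver.Hom.unop_inj
  refine ModuleCat.hom_ext (LinearMap.ext_ring ?_)
  change g ≫ ((1 : R) • f) = (1 : R) • (g ≫ f)
  simp

lemma homPoint_zero {X Y : ModuleCat.{0} R} : homPoint (0 : X ⟶ Y) = 0 := by
  apply Quiver.Hom.unop_inj
  refine ModuleCat.hom_ext (LinearMap.ext_ring ?_)
  change (1 : R) • (0 : X ⟶ Y) = 0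
  simp

lemma exists_homPoint {X Y : ModuleCat.{0} R} (h : (opYoneda Y).obj X ⟶ op (ModuleCat.of R R)) :
    ∃ f : X ⟶ Y, homPoint f = h := by
  refine ⟨h.unop.hom (1 : R), ?_⟩
  apply Quiver.Hom.unop_inj
  refine ModuleCat.hom_ext (LinearMap.ext_ring ?_)
  exact one_smul R _

lemma homPoint_injective {X Y : ModuleCat.{0} R} {f g : X ⟶ Y} (h : homPoint f = homPoint g) :
    f = g := by
  have := congrArg (fun t => t.unop.hom (1 : R)) h
  change (1 : R) • f = (1 : R) • g at this
  simpa using this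

noncomputable def resClass {X Y : ModuleCat.{0} R} (P : ProjectiveResolution X) {n : ℕ}
    (f : P.complex.X n ⟶ Y) (hf : P.complex.d (n + 1) n ≫ f = 0) :
    ((((opYoneda Y).mapHomologicalComplex _).obj P.complex).homology n) ⟶ op (ModuleCat.of R R) :=
  HomologicalComplex.homologyι _ n ≫ HomologicalComplex.descOpcycles _ (homPoint f) (n + 1)
    (by simp) (by
      change (opYoneda Y).map _ ≫ _ = 0
      rw [map_comp_homPoint, hf, homPoint_zero])

lemma homologyMap_comp_descOpcycles {C ι : Type*} [Category C] [Abelian C] {c : ComplexShape ι}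
    {K L : HomologicalComplex C c} (φ : K ⟶ L) {i j : ι} {A : C} (k : L.X i ⟶ A)
    (hj : c.prev i = j) (hk : L.d j i ≫ k = 0) :
    HomologicalComplex.homologyMap φ i ≫ L.homologyι i ≫ L.descOpcycles k j hj hk =
      K.homologyι i ≫ K.descOpcycles (φ.f i ≫ k) j hj
        (by rw [← φ.comm_assoc, hk, comp_zero]) := by
  rw [HomologicalComplex.homologyι_naturality_assoc,
    HomologicalComplex.opcyclesMap_comp_descOpcycles]

lemma resClass_naturality {X X' Y : ModuleCat.{0} R} (P : ProjectiveResolution X)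
    (P' : ProjectiveResolution X') (φ : P'.complex ⟶ P.complex) {n : ℕ}
    (f : P.complex.X n ⟶ Y) (hf : P.complex.d (n + 1) n ≫ f = 0) :
    HomologicalComplex.homologyMap (((opYoneda Y).mapHomologicalComplex _).map φ) n ≫
      resClass P f hf = resClass P' (φ.f n ≫ f) (by rw [← φ.comm_assoc, hf, comp_zero]) := by
  refine (homologyMap_comp_descOpcycles _ _ _ _).trans ?_
  unfold resClass
  congr 2

instance : Injective (op (ModuleCat.of R R)) := by
  have : Projective (ModuleCat.of R R) := inferInstance
  infer_instance

lemma extMk_eq_zero_of_resClass_eq_zero {X Y : ModuleCat.{0} R} (P : ProjectiveResolution X)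
    {n : ℕ} (f : P.complex.X n ⟶ Y) (hf : P.complex.d (n + 1) n ≫ f = 0)
    (h : resClass P f hf = 0) : P.extMk f (n + 1) rfl hf = 0 := by
  set K := ((opYoneda Y).mapHomologicalComplex (ComplexShape.down ℕ)).obj P.complex with hK
  have hp : (ComplexShape.down ℕ).prev n = n + 1 := by simp
  have hd : K.d (n + 1) n ≫ homPoint f = 0 := by
    change (opYoneda Y).map _ ≫ _ = 0
    rw [map_comp_homPoint, hf, homPoint_zero]
  let j := (ComplexShape.down ℕ).next n
  have hex : (ShortComplex.mk (K.homologyι n) (K.fromOpcycles n j)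
      (K.homologyι_comp_fromOpcycles n j)).Exact :=
    ShortComplex.exact_of_f_is_kernel _ (K.homologyIsKernel n j rfl)
  have h0 : K.homologyι n ≫ K.descOpcycles (homPoint f) (n + 1) hp hd = 0 := h
  let e := hex.descToInjective (K.descOpcycles (homPoint f) (n + 1) hp hd) h0
  have he : K.fromOpcycles n j ≫ e = K.descOpcycles (homPoint f) (n + 1) hp hd :=
    hex.comp_descToInjective _ h0
  obtain ⟨g, hg⟩ := exists_homPoint e
  have hfg : P.complex.d n j ≫ g = f := by
    apply homPoint_injective
    rw [← map_comp_homPoint, hg]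
    have := congrArg (fun t => K.pOpcycles n ≫ t) he
    simp only [HomologicalComplex.p_fromOpcycles_assoc] at this
    exact this.trans (K.p_descOpcycles _ _ _ _)
  cases n with
  | zero =>
    have : f = 0 := by
      rw [← hfg, P.complex.shape _ _ (by simp), zero_comp]
    subst this
    simp
  | succ p =>
    rw [P.extMk_eq_zero_iff f _ rfl hf p rfl]
    have hj : j = p := by simp [j]
    clear_value j
    subst hj
    exact ⟨g, hfg⟩

/-- A class in the derived-category `Ext` gives an element of the left-derived-functor `Ext`
whose pullbacks detect the pullbacks of the class. -/
lemma exists_ext_element {X Y : ModuleCat.{0} R} {n : ℕ} (α : Abelian.Ext X Y n) :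
    ∃ a : ((Ext R (ModuleCat.{0} R) n).obj (op X)).obj Y,
      ∀ (X' : ModuleCat.{0} R) (g : X' ⟶ X),
        (((Ext R (ModuleCat.{0} R) n).map g.op).app Y).hom a = 0 →
          (Abelian.Ext.mk₀ g).comp α (zero_add n) = 0 := by
  let P := projectiveResolution X
  obtain ⟨f, hf, rfl⟩ := P.extMk_surjective α (n + 1) rfl
  let c := (P.isoLeftDerivedObj (opYoneda Y) n).hom ≫ resClass P f hf
  refine ⟨c.unop.hom (1 : R), fun X' g hg => ?_⟩
  let P' := projectiveResolution X'
  let φ := ProjectiveResolution.lift g P' P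
  have hφ := ProjectiveResolution.lift_commutes_zero g P' P
  rw [P.mk₀_comp_extMk (R' := P') f _ rfl hf ⟨φ, by simpa using hφ⟩]
  apply extMk_eq_zero_of_resClass_eq_zero
  rw [← resClass_naturality P P' φ f hf]
  have h1 : ((opYoneda Y).leftDerived n).map g ≫ c = 0 := by
    apply Quiver.Hom.unop_inj
    refine ModuleCat.hom_ext (LinearMap.ext_ring ?_)
    exact hg
  have h2 := ProjectiveResolution.isoLeftDerivedObj_hom_naturality g P' P φ hφ (opYoneda Y) n
  refine (cancel_epi (P'.isoLeftDerivedObj (opYoneda Y) n).hom).1 (Eq.trans ?_ (h1.trans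
    comp_zero.symm))
  have h3 := congrArg (fun t => t ≫ resClass P f hf) h2
  exact ((Category.assoc _ _ _).symm.trans h3.symm).trans (Category.assoc _ _ _)

lemma nontrivial_localCohomology (J : Ideal R) (M : ModuleCat.{0} R) (n : ℕ)
    (α : Abelian.Ext (ModuleCat.of R (R ⧸ J)) M n)
    (hα : ∀ (t : ℕ) (h : J ^ t ≤ J), (Abelian.Ext.mk₀ (ModuleCat.ofHom
      (Submodule.mapQ (J ^ t) J LinearMap.id h))).comp α (zero_add n) ≠ 0) :
    Nontrivial ((localCohomology J n).obj M) := by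
  obtain ⟨β, hβ⟩ : ∃ β : Abelian.Ext (ModuleCat.of R (R ⧸ (J ^ 1))) M n,
      ∀ (t : ℕ) (h : J ^ t ≤ J ^ 1), (Abelian.Ext.mk₀ (ModuleCat.ofHom
        (Submodule.mapQ (J ^ t) (J ^ 1) LinearMap.id h))).comp β (zero_add n) ≠ 0 := by
    rw [pow_one]
    exact ⟨α, hα⟩
  obtain ⟨a, ha⟩ := exists_ext_element β
  let D := localCohomology.diagram (localCohomology.idealPowersDiagram J) n
  let E := D ⋙ (evaluation _ _).obj M
  let x : E.obj (op (op 1)) := a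
  let e : (localCohomology J n).obj M ≅ colimit E := colimitObjIsoColimitCompEvaluation D M
  have hx : colimit.ι E (op (op 1)) x ≠ 0 := by
    intro h
    obtain ⟨j, i, hi⟩ := Concrete.colimit_rep_eq_zero _ _ _ x h
    obtain ⟨⟨t⟩⟩ := j
    exact hβ t (Ideal.pow_le_pow_right i.unop.unop.down.down) (ha _ _ hi)
  have : Nontrivial (colimit E : ModuleCat R) := ⟨_, _, hx⟩
  exact (e.toLinearEquiv.toEquiv).nontrivial

noncomputable abbrev quotMap {I J : Ideal R} (h : I ≤ J) :
    ModuleCat.of R (R ⧸ I) ⟶ ModuleCat.of R (R ⧸ J) :=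
  ModuleCat.ofHom (Submodule.mapQ I J LinearMap.id h)

lemma quotMap_comp {I J K : Ideal R} (h : I ≤ J) (h' : J ≤ K) :
    quotMap h ≫ quotMap h' = quotMap (h.trans h') := by
  refine ModuleCat.hom_ext (LinearMap.ext fun x => ?_)
  obtain ⟨x, rfl⟩ := Submodule.mkQ_surjective _ x
  rfl

lemma quotMap_self {I : Ideal R} : quotMap (le_refl I) = 𝟙 _ := by
  refine ModuleCat.hom_ext (LinearMap.ext fun x => ?_)
  obtain ⟨x, rfl⟩ := Submodule.mkQ_surjective _ x
  rfl

lemma exists_mem_socle {m I J : Ideal R} {t : ℕ} (ht : m ^ t ≤ I) (hIJ : I < J) :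
    ∃ a ∈ J, a ∉ I ∧ ∀ x ∈ m, x * a ∈ I := by
  classical
  have hex : ∃ u, m ^ u * J ≤ I := ⟨t, le_trans Ideal.mul_le_left ht⟩
  have hpos : Nat.find hex ≠ 0 := by
    intro h
    have := Nat.find_spec hex
    rw [h, pow_zero, one_mul] at this
    exact hIJ.not_ge this
  obtain ⟨u, hu⟩ := Nat.exists_eq_succ_of_ne_zero hpos
  have hmin : ¬ m ^ u * J ≤ I := Nat.find_min hex (by omega)
  obtain ⟨a, ha, haI⟩ := SetLike.not_le_iff_exists.1 hmin
  refine ⟨a, Ideal.mul_le_right ha, haI, fun x hx => Nat.find_spec hex ?_⟩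
  rw [hu, Nat.succ_eq_add_one, pow_succ', mul_assoc]
  exact Ideal.mul_mem_mul hx ha

lemma precomp_quotMap_sup_injective {m I : Ideal R} [m.IsMaximal] {a : R} (ha : a ∉ I)
    (hma : ∀ x ∈ m, x * a ∈ I) {M : ModuleCat.{0} R} {n : ℕ}
    (hprev : ∀ n', 1 + n' = n → ∀ α : Abelian.Ext (ModuleCat.of R (R ⧸ m)) M n', α = 0)
    (β : Abelian.Ext (ModuleCat.of R (R ⧸ (I ⊔ Ideal.span {a}))) M n)
    (hβ : (Abelian.Ext.mk₀ (quotMap (le_sup_left : I ≤ I ⊔ Ideal.span {a}))).comp β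
      (zero_add n) = 0) : β = 0 := by
  let f : (R ⧸ m) →ₗ[R] (R ⧸ I) := Submodule.liftQ m (LinearMap.toSpanSingleton R _
    (Submodule.Quotient.mk a)) fun x hx => by
      simp only [LinearMap.mem_ker, LinearMap.toSpanSingleton_apply]
      rw [← Submodule.Quotient.mk_smul, Submodule.Quotient.mk_eq_zero]
      exact hma x hx
  let S : ShortComplex (ModuleCat.{0} R) := ShortComplex.mk (ModuleCat.ofHom f)
    (quotMap (le_sup_left : I ≤ I ⊔ Ideal.span {a})) (by
      refine ModuleCat.hom_ext (LinearMap.ext fun x => ?_)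
      obtain ⟨x, rfl⟩ := Submodule.mkQ_surjective _ x
      change (Submodule.Quotient.mk (x • a) : R ⧸ (I ⊔ Ideal.span {a})) = 0
      rw [Submodule.Quotient.mk_eq_zero]
      exact Ideal.mul_mem_left _ _ (Ideal.mem_sup_right (Ideal.mem_span_singleton_self a)))
  have hS : S.ShortExact := by
    refine ModuleCat.shortComplex_shortExact S ?_ ?_ ?_
    · intro y
      obtain ⟨y, rfl⟩ := Submodule.mkQ_surjective _ y
      constructor
      · intro hy
        have hy' : y ∈ I ⊔ Ideal.span {a} := (Submodule.Quotient.mk_eq_zero _).1 hy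
        obtain ⟨i, hi, z, hz, rfl⟩ := Submodule.mem_sup.1 hy'
        obtain ⟨c, rfl⟩ := Ideal.mem_span_singleton'.1 hz
        refine ⟨Submodule.Quotient.mk c, ?_⟩
        change (Submodule.Quotient.mk (c • a) : R ⧸ I) = Submodule.Quotient.mk (i + c * a)
        rw [Submodule.Quotient.eq]
        simpa using hi
      · rintro ⟨x, hx⟩
        rw [← hx]
        exact congrArg (fun t => t.hom x) S.zero
    · refine (injective_iff_map_eq_zero (f : (R ⧸ m) →+ (R ⧸ I))).2 fun x hx => ?_
      obtain ⟨x, rfl⟩ := Submodule.mkQ_surjective _ x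
      have hx' : x * a ∈ I := (Submodule.Quotient.mk_eq_zero (p := I) (x := x • a)).1 hx
      refine (Submodule.Quotient.mk_eq_zero _).2 ?_
      by_contra hxm
      obtain ⟨y, i, hi, hyi⟩ := (inferInstance : m.IsMaximal).exists_inv hxm
      refine ha ?_
      rw [← one_mul a, ← hyi, add_mul, mul_assoc]
      exact I.add_mem (I.mul_mem_left _ hx') (hma i hi)
    · intro y
      obtain ⟨y, rfl⟩ := Submodule.mkQ_surjective _ y
      exact ⟨Submodule.Quotient.mk y, rfl⟩
  cases n with
  | zero =>
    have := hS.epi_g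
    exact (injective_iff_map_eq_zero _).1
      (Abelian.Ext.precomp_mk₀_injective_of_epi M S.g) β hβ
  | succ n =>
    obtain ⟨γ, rfl⟩ := Abelian.Ext.contravariant_sequence_exact₃ hS M β hβ
      (n₀ := n) (add_comm _ _)
    rw [hprev n (add_comm _ _) γ, Abelian.Ext.comp_zero]

lemma precomp_quotMap_injective [IsNoetherianRing R] {m J : Ideal R} [m.IsMaximal]
    {M : ModuleCat.{0} R} {n t : ℕ}
    (hprev : ∀ n', 1 + n' = n → ∀ α : Abelian.Ext (ModuleCat.of R (R ⧸ m)) M n', α = 0)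
    (β : Abelian.Ext (ModuleCat.of R (R ⧸ J)) M n) (I : Ideal R) (ht : m ^ t ≤ I) (hIJ : I ≤ J)
    (hβ : (Abelian.Ext.mk₀ (quotMap hIJ)).comp β (zero_add n) = 0) : β = 0 := by
  induction I using IsNoetherian.induction with
  | hgt I ih =>
    rcases eq_or_lt_of_le hIJ with rfl | hlt
    · rwa [quotMap_self, Abelian.Ext.mk₀_id_comp] at hβ
    · obtain ⟨a, haJ, haI, hma⟩ := exists_mem_socle ht hlt
      have hle : I ⊔ Ideal.span {a} ≤ J :=
        sup_le hIJ ((Ideal.span_singleton_le_iff_mem _).2 haJ)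
      have hgt : I < I ⊔ Ideal.span {a} := lt_of_le_of_ne le_sup_left fun h => haI
        (h ▸ Ideal.mem_sup_right (Ideal.mem_span_singleton_self a))
      refine ih _ hgt (ht.trans le_sup_left) hle ?_
      refine precomp_quotMap_sup_injective haI hma hprev _ ?_
      rw [Abelian.Ext.mk₀_comp_mk₀_assoc, quotMap_comp]
      exact hβ

/-- The depth read off from local cohomology is at most any degree in which `Ext (R ⧸ m)`
does not vanish. -/
lemma exists_nontrivial_localCohomology_le [IsNoetherianRing R] {m : Ideal R} [m.IsMaximal]
    {M : ModuleCat.{0} R} {n : ℕ} (α : Abelian.Ext (ModuleCat.of R (R ⧸ m)) M n) (hα : α ≠ 0) :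
    ∃ i ≤ n, Nontrivial ((localCohomology m i).obj M) := by
  classical
  have hex : ∃ i, ∃ α : Abelian.Ext (ModuleCat.of R (R ⧸ m)) M i, α ≠ 0 := ⟨n, α, hα⟩
  obtain ⟨γ, hγ⟩ := Nat.find_spec hex
  refine ⟨Nat.find hex, Nat.find_min' hex ⟨α, hα⟩, nontrivial_localCohomology m M _ γ ?_⟩
  intro t h h0
  refine hγ (precomp_quotMap_injective (t := t) (fun n' hn' δ => ?_) γ (m ^ t) le_rfl h h0)
  by_contra hδ
  exact Nat.find_min hex (by omega) ⟨δ, hδ⟩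

end ExtComparison

section QuotientChains

variable {R : Type} [CommRing R]

/-- A sequence of modules, each the quotient of the previous one by a nonzerodivisor. -/
structure QuotientChain (x : ℕ → R) where
  obj : ℕ → ModuleCat.{0} R
  proj (r : ℕ) : obj r ⟶ obj (r + 1)
  smul_comp_proj (r : ℕ) : (x r • 𝟙 (obj r)) ≫ proj r = 0
  shortExact (r : ℕ) : (ShortComplex.mk _ _ (smul_comp_proj r)).ShortExact

namespace QuotientChain

variable {x : ℕ → R}

/-- Morphisms of quotient chains. -/
structure Hom (A B : QuotientChain x) where
  app (r : ℕ) : A.obj r ⟶ B.obj r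
  comm (r : ℕ) : app r ≫ B.proj r = A.proj r ≫ app (r + 1)

/-- The iterated extension class `A r ⟶ (A 0)[r]` of a quotient chain. -/
noncomputable def extClass (A : QuotientChain x) : ∀ r, Abelian.Ext (A.obj r) (A.obj 0) r
  | 0 => Abelian.Ext.mk₀ (𝟙 _)
  | r + 1 => (A.shortExact r).extClass.comp (A.extClass r) (add_comm 1 r)

lemma extClass_naturality {A B : QuotientChain x} (η : A.Hom B) (r : ℕ) :
    (Abelian.Ext.mk₀ (η.app r)).comp (B.extClass r) (zero_add r) =
      (A.extClass r).comp (Abelian.Ext.mk₀ (η.app 0)) (add_zero r) := by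
  induction r with
  | zero => simp [extClass]
  | succ r ih =>
    have h := ShortComplex.ShortExact.extClass_naturality (A.shortExact r) (B.shortExact r)
      { τ₁ := η.app r
        τ₂ := η.app r
        τ₃ := η.app (r + 1)
        comm₁₂ := by simp
        comm₂₃ := η.comm r }
    dsimp only at h
    simp only [extClass]
    rw [← Abelian.Ext.comp_assoc (a₁₂ := 1) (h₁₂ := zero_add 1) (h := by omega), ← h,
      Abelian.Ext.comp_assoc (a₂₃ := r) (h₂₃ := zero_add r) (h := by omega), ih,
      Abelian.Ext.comp_assoc (a₂₃ := r) (h₂₃ := add_zero r) (h := by omega)]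

lemma ext_eq_zero (A : QuotientChain x) [Projective (A.obj 0)] {M : ModuleCat.{0} R} {r i : ℕ}
    (h : r < i) (α : Abelian.Ext (A.obj r) M i) : α = 0 := by
  induction r generalizing i with
  | zero =>
    obtain ⟨i, rfl⟩ := Nat.exists_eq_succ_of_ne_zero h.ne'
    exact Abelian.Ext.eq_zero_of_projective α
  | succ r ih =>
    obtain ⟨i, rfl⟩ := Nat.exists_eq_succ_of_ne_zero (by omega : i ≠ 0)
    obtain ⟨β, rfl⟩ := Abelian.Ext.contravariant_sequence_exact₃ (A.shortExact r) M α
      (ih (by omega) _) (n₀ := i) (add_comm _ _)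
    rw [ih (by omega) β, Abelian.Ext.comp_zero]

variable (A : QuotientChain x) [Projective (A.obj 0)] {M : ModuleCat.{0} R}

lemma exists_extClass_comp_eq {r : ℕ} (α : Abelian.Ext (A.obj r) M r) :
    ∃ w : A.obj 0 ⟶ M, (A.extClass r).comp (Abelian.Ext.mk₀ w) (add_zero r) = α := by
  induction r with
  | zero =>
    obtain ⟨w, rfl⟩ := (Abelian.Ext.mk₀_bijective _ _).2 α
    exact ⟨w, by simp [extClass]⟩
  | succ r ih =>
    obtain ⟨β, rfl⟩ := Abelian.Ext.contravariant_sequence_exact₃ (A.shortExact r) M α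
      (A.ext_eq_zero (by omega) _) (n₀ := r) (add_comm _ _)
    obtain ⟨w, rfl⟩ := ih β
    refine ⟨w, ?_⟩
    simp only [extClass]
    rw [Abelian.Ext.comp_assoc (a₂₃ := r) (h₂₃ := add_zero r) (h := by omega)]

lemma exists_eq_sum_of_extClass_comp_eq_zero {r : ℕ} (w : A.obj 0 ⟶ M)
    (hw : (A.extClass r).comp (Abelian.Ext.mk₀ w) (add_zero r) = 0) :
    ∃ v : ℕ → (A.obj 0 ⟶ M), w = ∑ i ∈ Finset.range r, x i • v i := by
  induction r generalizing w with
  | zero =>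
    refine ⟨0, ?_⟩
    simpa [extClass, Abelian.Ext.mk₀_eq_zero_iff] using hw
  | succ r ih =>
    simp only [extClass] at hw
    rw [Abelian.Ext.comp_assoc (a₂₃ := r) (h₂₃ := add_zero r) (h := by omega)] at hw
    obtain ⟨β, hβ⟩ := Abelian.Ext.contravariant_sequence_exact₁ (A.shortExact r) M _ _ hw
    obtain ⟨u, rfl⟩ := A.exists_extClass_comp_eq β
    dsimp only at hβ
    rw [Abelian.Ext.mk₀_smul, Abelian.Ext.smul_comp, Abelian.Ext.mk₀_id_comp,
      ← Abelian.Ext.comp_smul, ← Abelian.Ext.mk₀_smul] at hβ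
    obtain ⟨v, hv⟩ := ih (w - x r • u) (by
      rw [sub_eq_add_neg, Abelian.Ext.mk₀_add, Abelian.Ext.comp_add, Abelian.Ext.mk₀_neg,
        Abelian.Ext.comp_neg, hβ, add_neg_cancel])
    refine ⟨Function.update v r u, ?_⟩
    rw [Finset.sum_range_succ, Function.update_self, ← sub_eq_iff_eq_add, hv]
    refine Finset.sum_congr rfl fun i hi => ?_
    rw [Function.update_of_ne (Finset.mem_range.1 hi).ne]

/-- If the cokernel of `ι n` has no `Ext` into `M` in degree `n + 1`, then every morphism
`B 0 ⟶ M` agrees with the restriction of a morphism `A 0 ⟶ M`, up to an ambiguity that becomes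
a multiple of `x 0, …, x (n - 1)` after pulling back along morphisms from `A`. -/
lemma exists_lift {B : QuotientChain x} (ι : B.Hom A) {n : ℕ} {K : ModuleCat.{0} R}
    (q : A.obj n ⟶ K) (hq : ι.app n ≫ q = 0) (hS : (ShortComplex.mk _ _ hq).ShortExact)
    (hK : ∀ α : Abelian.Ext K M (n + 1), α = 0) (φ : B.obj 0 ⟶ M) :
    ∃ w : A.obj 0 ⟶ M, ∀ c : A.Hom B, ∃ v : ℕ → (A.obj 0 ⟶ M),
      c.app 0 ≫ φ - c.app 0 ≫ ι.app 0 ≫ w = ∑ i ∈ Finset.range n, x i • v i := by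
  obtain ⟨ψ, hψ⟩ := Abelian.Ext.contravariant_sequence_exact₁ hS M
    ((B.extClass n).comp (Abelian.Ext.mk₀ φ) (add_zero n)) (add_comm 1 n) (hK _)
  obtain ⟨w, rfl⟩ := A.exists_extClass_comp_eq ψ
  dsimp only at hψ
  rw [← Abelian.Ext.comp_assoc (a₁₂ := n) (h₁₂ := zero_add n) (h := by omega),
    extClass_naturality, Abelian.Ext.comp_assoc (a₂₃ := 0) (h₂₃ := add_zero 0) (h := by omega),
    Abelian.Ext.mk₀_comp_mk₀] at hψ
  refine ⟨w, fun c => A.exists_eq_sum_of_extClass_comp_eq_zero (r := n) _ ?_⟩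
  rw [← Preadditive.comp_sub, ← Abelian.Ext.mk₀_comp_mk₀,
    ← Abelian.Ext.comp_assoc (a₁₂ := n) (h₁₂ := add_zero n) (h := by omega),
    ← extClass_naturality, Abelian.Ext.comp_assoc (a₂₃ := n) (h₂₃ := add_zero n) (h := by omega),
    sub_eq_add_neg, Abelian.Ext.mk₀_add, Abelian.Ext.comp_add, Abelian.Ext.mk₀_neg,
    Abelian.Ext.comp_neg, hψ, add_neg_cancel, Abelian.Ext.comp_zero]

end QuotientChain

/-- The ideal generated by the first `r` terms of a sequence. -/
abbrev initialIdeal (x : ℕ → R) (r : ℕ) : Ideal R := Ideal.span (x '' Set.Iio r)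

lemma initialIdeal_zero (x : ℕ → R) : initialIdeal x 0 = ⊥ := by
  simp [initialIdeal]

lemma initialIdeal_succ (x : ℕ → R) (r : ℕ) :
    initialIdeal x (r + 1) = initialIdeal x r ⊔ Ideal.span {x r} := by
  have : Set.Iio (r + 1) = Set.Iio r ∪ {r} := by
    ext i
    simp only [Set.mem_Iio, Set.mem_union, Set.mem_singleton_iff]
    omega
  rw [initialIdeal, this, Set.image_union, Set.image_singleton, Ideal.span_union]

lemma initialIdeal_le_succ (x : ℕ → R) (r : ℕ) : initialIdeal x r ≤ initialIdeal x (r + 1) := by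
  rw [initialIdeal_succ]
  exact le_sup_left

lemma mem_initialIdeal_succ (x : ℕ → R) (r : ℕ) : x r ∈ initialIdeal x (r + 1) :=
  Ideal.subset_span ⟨r, r.lt_succ_self, rfl⟩

lemma exists_of_mem_initialIdeal_succ_sup {x : ℕ → R} {r : ℕ} {J : Ideal R} {a : R}
    (ha : a ∈ initialIdeal x (r + 1) ⊔ J) :
    ∃ b ∈ initialIdeal x r ⊔ J, ∃ c, a = b + x r * c := by
  rw [initialIdeal_succ, sup_right_comm] at ha
  obtain ⟨b, hb, z, hz, rfl⟩ := Submodule.mem_sup.1 ha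
  obtain ⟨c, rfl⟩ := Ideal.mem_span_singleton'.1 hz
  exact ⟨b, hb, c, by rw [mul_comm]⟩

/-- The subquotient `Q / (P ∩ Q)` of two ideals. -/
abbrev subquotient (P Q : Ideal R) : ModuleCat.{0} R :=
  ModuleCat.of R (Q ⧸ Submodule.comap Q.subtype P)

/-- The map of subquotients given by multiplication by a ring element. -/
noncomputable abbrev subquotientMap {P Q P' Q' : Ideal R} (c : R) (hP : ∀ a ∈ P, c * a ∈ P')
    (hQ : ∀ a ∈ Q, c * a ∈ Q') : subquotient P Q ⟶ subquotient P' Q' :=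
  ModuleCat.ofHom (Submodule.mapQ _ _
    ((LinearMap.lsmul R R c).restrict (p := Q) (q := Q') hQ) fun _ => hP _)

lemma smul_mem_initialIdeal_sup {x : ℕ → R} {r : ℕ} {J J' : Ideal R} {c : R}
    (h : ∀ a ∈ J, c * a ∈ J') {a : R} (ha : a ∈ initialIdeal x r ⊔ J) :
    c * a ∈ initialIdeal x r ⊔ J' := by
  obtain ⟨b, hb, z, hz, rfl⟩ := Submodule.mem_sup.1 ha
  rw [mul_add]
  exact Ideal.add_mem _ (Ideal.mem_sup_left (Ideal.mul_mem_left _ _ hb))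
    (Ideal.mem_sup_right (h z hz))

lemma subquotient_mk_eq_zero {P Q : Ideal R} {a : R} (ha : a ∈ Q) :
    (Submodule.Quotient.mk ⟨a, ha⟩ : subquotient P Q) = 0 ↔ a ∈ P :=
  Submodule.Quotient.mk_eq_zero _

namespace QuotientChain

variable {x : ℕ → R} {J J' : Ideal R}

/-- The quotient chain with terms `(x 0, …, x (r - 1)) + J` modulo `(x 0, …, x (r - 1))`. -/
noncomputable def ofIdeal (x : ℕ → R) (J : Ideal R)
    (h : ∀ r a, x r * a ∈ initialIdeal x r → a ∈ initialIdeal x r)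
    (hJ : ∀ r a, x r * a ∈ initialIdeal x r ⊔ J → a ∈ initialIdeal x r ⊔ J) :
    QuotientChain x where
  obj r := subquotient (initialIdeal x r) (initialIdeal x r ⊔ J)
  proj r := subquotientMap 1 (fun a ha => by simpa using initialIdeal_le_succ x r ha)
    (fun a ha => by simpa using sup_le_sup_right (initialIdeal_le_succ x r) J ha)
  smul_comp_proj r := by
    refine ModuleCat.hom_ext (LinearMap.ext fun a => ?_)
    obtain ⟨a, rfl⟩ := Submodule.mkQ_surjective _ a
    refine (Submodule.Quotient.mk_eq_zero _).2 ?_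
    change (1 : R) * (x r * a) ∈ initialIdeal x (r + 1)
    rw [one_mul]
    exact Ideal.mul_mem_right _ _ (mem_initialIdeal_succ x r)
  shortExact r := by
    refine ModuleCat.shortComplex_shortExact _ ?_ ?_ ?_
    · intro a
      obtain ⟨a, rfl⟩ := Submodule.mkQ_surjective _ a
      constructor
      · intro ha
        have ha' : (1 : R) * (a : R) ∈ initialIdeal x (r + 1) :=
          (subquotient_mk_eq_zero (by
            simpa using sup_le_sup_right (initialIdeal_le_succ x r) J a.2)).1 ha
        rw [one_mul, ← sup_bot_eq (initialIdeal x (r + 1))] at ha'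
        obtain ⟨b, hb, c, hc⟩ := exists_of_mem_initialIdeal_succ_sup ha'
        rw [sup_bot_eq] at hb
        have hcQ : c ∈ initialIdeal x r ⊔ J := by
          refine hJ r c ?_
          rw [← sub_eq_iff_eq_add'.2 hc]
          exact Ideal.sub_mem _ a.2 (Ideal.mem_sup_left hb)
        refine ⟨Submodule.Quotient.mk ⟨c, hcQ⟩, (Submodule.Quotient.eq _).2 ?_⟩
        change x r * c - (a : R) ∈ initialIdeal x r
        rw [hc, sub_add_cancel_right]
        exact Ideal.neg_mem_iff _ |>.2 hb
      · rintro ⟨b, hb⟩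
        rw [← hb]
        obtain ⟨b, rfl⟩ := Submodule.mkQ_surjective _ b
        refine (Submodule.Quotient.mk_eq_zero _).2 ?_
        change (1 : R) * (x r * b) ∈ initialIdeal x (r + 1)
        rw [one_mul]
        exact Ideal.mul_mem_right _ _ (mem_initialIdeal_succ x r)
    · refine (injective_iff_map_eq_zero (ModuleCat.Hom.hom _)).2 fun a ha => ?_
      obtain ⟨a, rfl⟩ := Submodule.mkQ_surjective _ a
      have ha' : x r * (a : R) ∈ initialIdeal x r :=
        (subquotient_mk_eq_zero (Ideal.mul_mem_left _ _ a.2)).1 ha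
      exact (Submodule.Quotient.mk_eq_zero _).2 (h r _ ha')
    · intro a
      obtain ⟨⟨a, ha⟩, rfl⟩ := Submodule.mkQ_surjective _ a
      obtain ⟨b, hb, c, rfl⟩ := exists_of_mem_initialIdeal_succ_sup ha
      refine ⟨Submodule.Quotient.mk ⟨b, hb⟩, (Submodule.Quotient.eq _).2 ?_⟩
      change 1 * b - (b + x r * c) ∈ initialIdeal x (r + 1)
      rw [one_mul, sub_add_cancel_left, Ideal.neg_mem_iff]
      exact Ideal.mul_mem_right _ _ (mem_initialIdeal_succ x r)

/-- Multiplication by an element carrying `J` into `J'`, as a morphism of quotient chains. -/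
noncomputable def mulHom (c : R) (hc : ∀ a ∈ J, c * a ∈ J')
    (h : ∀ r a, x r * a ∈ initialIdeal x r → a ∈ initialIdeal x r)
    (hJ : ∀ r a, x r * a ∈ initialIdeal x r ⊔ J → a ∈ initialIdeal x r ⊔ J)
    (hJ' : ∀ r a, x r * a ∈ initialIdeal x r ⊔ J' → a ∈ initialIdeal x r ⊔ J') :
    (ofIdeal x J h hJ).Hom (ofIdeal x J' h hJ') where
  app r := subquotientMap c (fun _ => Ideal.mul_mem_left _ _)
    (fun _ => smul_mem_initialIdeal_sup hc)
  comm r := by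
    refine ModuleCat.hom_ext (LinearMap.ext fun a => ?_)
    obtain ⟨a, rfl⟩ := Submodule.mkQ_surjective _ a
    refine congrArg Submodule.Quotient.mk (Subtype.ext ?_)
    change 1 * (c * (a : R)) = c * (1 * (a : R))
    rw [one_mul, one_mul]

end QuotientChain

open QuotientChain in
/-- If `x` is a regular sequence modulo `0` and modulo `J`, and `m` is generated by `J` and the
first `n` terms of `x`, then the vanishing of `Ext` from `R ⧸ m` in degree `n + 1` forces every
linear map from `J` to be multiplication by an element, modulo the first `n` terms of `x`. -/
lemma exists_forall_sub_smul_eq_sum {x : ℕ → R} {J m : Ideal R} {n : ℕ}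
    (h : ∀ r a, x r * a ∈ initialIdeal x r → a ∈ initialIdeal x r)
    (hJ : ∀ r a, x r * a ∈ initialIdeal x r ⊔ J → a ∈ initialIdeal x r ⊔ J)
    (hm : initialIdeal x n ⊔ J = m) {M : Type} [AddCommGroup M] [Module R M]
    (hM : ∀ α : Abelian.Ext (ModuleCat.of R (R ⧸ m)) (ModuleCat.of R M) (n + 1), α = 0)
    (φ : J →ₗ[R] M) :
    ∃ w : M, ∀ c : J, ∃ v : ℕ → M, φ c - (c : R) • w = ∑ i ∈ Finset.range n, x i • v i := by
  subst hm
  have htop : ∀ r a, x r * a ∈ initialIdeal x r ⊔ ⊤ → a ∈ initialIdeal x r ⊔ ⊤ := by simp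
  let A := ofIdeal x ⊤ h htop
  let B := ofIdeal x J h hJ
  let ι : B.Hom A := mulHom 1 (fun _ _ => Submodule.mem_top) h hJ htop
  have hbot : Submodule.comap (initialIdeal x 0 ⊔ ⊤).subtype (initialIdeal x 0) = ⊥ := by
    rw [eq_bot_iff]
    intro a ha
    exact Subtype.ext ((initialIdeal_zero x).le ha)
  have hQ : initialIdeal x 0 ⊔ ⊤ = ⊤ := sup_top_eq _
  have : Module.Projective R (A.obj 0) := Module.Projective.of_equiv
    ((Submodule.quotEquivOfEqBot _ hbot).trans
      ((LinearEquiv.ofEq _ _ hQ).trans Submodule.topEquiv)).symm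
  have : Projective (A.obj 0) := inferInstance
  let q : A.obj n ⟶ ModuleCat.of R (R ⧸ initialIdeal x n ⊔ J) :=
    ModuleCat.ofHom (Submodule.mapQ _ _ (Submodule.subtype _) fun _ ha => Ideal.mem_sup_left ha)
  have hq : ι.app n ≫ q = 0 := by
    refine ModuleCat.hom_ext (LinearMap.ext fun a => ?_)
    obtain ⟨a, rfl⟩ := Submodule.mkQ_surjective _ a
    refine (Submodule.Quotient.mk_eq_zero _).2 ?_
    change 1 * (a : R) ∈ _
    rw [one_mul]
    exact a.2
  have hS : (ShortComplex.mk _ _ hq).ShortExact := by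
    refine ModuleCat.shortComplex_shortExact _ ?_ ?_ ?_
    · intro a
      obtain ⟨a, rfl⟩ := Submodule.mkQ_surjective _ a
      constructor
      · intro ha
        have ha' : (a : R) ∈ initialIdeal x n ⊔ J := (Submodule.Quotient.mk_eq_zero _).1 ha
        refine ⟨Submodule.Quotient.mk ⟨a, ha'⟩, ?_⟩
        refine congrArg Submodule.Quotient.mk (Subtype.ext ?_)
        exact one_mul (a : R)
      · rintro ⟨b, hb⟩
        rw [← hb]
        exact congrArg (fun t => t.hom b) hq
    · refine (injective_iff_map_eq_zero (ModuleCat.Hom.hom _)).2 fun a ha => ?_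
      obtain ⟨a, rfl⟩ := Submodule.mkQ_surjective _ a
      have ha' : 1 * (a : R) ∈ initialIdeal x n :=
        (subquotient_mk_eq_zero (Ideal.mem_sup_right Submodule.mem_top)).1 ha
      rw [one_mul] at ha'
      exact (Submodule.Quotient.mk_eq_zero _).2 ha'
    · intro a
      obtain ⟨a, rfl⟩ := Submodule.mkQ_surjective _ a
      exact ⟨Submodule.Quotient.mk ⟨a, Ideal.mem_sup_right Submodule.mem_top⟩, rfl⟩
  have hle : initialIdeal x 0 ⊔ J ≤ J := by rw [initialIdeal_zero, bot_sup_eq]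
  let φ' : B.obj 0 ⟶ ModuleCat.of R M := ModuleCat.ofHom
    (Submodule.liftQ _ (φ ∘ₗ Submodule.inclusion hle) fun a ha => by
      have : a = 0 := Subtype.ext ((initialIdeal_zero x).le ha)
      rw [this]
      exact Submodule.zero_mem _)
  obtain ⟨w, hw⟩ := A.exists_lift ι q hq hS hM φ'
  let one : A.obj 0 := Submodule.Quotient.mk ⟨1, Ideal.mem_sup_right Submodule.mem_top⟩
  refine ⟨w.hom one, fun c => ?_⟩
  obtain ⟨v, hv⟩ := hw (mulHom (c : R) (fun a _ => Ideal.mul_mem_right _ _ c.2) h htop hJ)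
  refine ⟨fun i => (v i).hom one, ?_⟩
  have hv' := congrArg (fun t => t.hom one) hv
  simp only [ModuleCat.hom_sub, ModuleCat.hom_sum, ModuleCat.hom_smul, LinearMap.sub_apply,
    LinearMap.sum_apply, LinearMap.smul_apply] at hv'
  refine Eq.trans (congrArg₂ _ ?_ ?_) hv'
  · refine congrArg φ (Subtype.ext ?_)
    exact (mul_one (c : R)).symm
  · rw [← map_smul]
    refine congrArg w.hom (congrArg Submodule.Quotient.mk (Subtype.ext ?_))
    exact (one_mul ((c : R) * 1)).symm

end QuotientChains

end HomologicalAlgebra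

section Polynomial

variable {k : Type} [Field k] {V : Type}

lemma maxHomIdeal_eq_ker : maxHomIdeal k V = RingHom.ker (constantCoeff (R := k) (σ := V)) := by
  ext p
  have h := mem_pow_idealOfVars_iff' (R := k) (σ := V) 1 p
  rw [pow_one] at h
  refine h.trans ?_
  rw [RingHom.mem_ker, constantCoeff_eq]
  constructor
  · exact fun h => h 0 (by simp)
  · intro h m hm
    rw [(Finsupp.degree_eq_zero_iff m).1 (by omega), h]

instance : (maxHomIdeal k V).IsMaximal := by
  rw [maxHomIdeal_eq_ker]
  exact RingHom.ker_isMaximal_of_surjective _ fun a => ⟨C a, by simp⟩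

lemma mem_span_X_image_of_X_mul_mem {s : Set V} {v : V} (hv : v ∉ s) {p : MvPolynomial V k}
    (hp : X v * p ∈ Ideal.span ((X : V → MvPolynomial V k) '' s)) :
    p ∈ Ideal.span ((X : V → MvPolynomial V k) '' s) := by
  rw [mem_ideal_span_X_image] at hp ⊢
  intro m hm
  obtain ⟨i, hi, hmi⟩ := hp (Finsupp.single v 1 + m) (by
    rwa [mem_support_iff, coeff_X_mul, ← mem_support_iff])
  refine ⟨i, hi, ?_⟩
  have hiv : v ≠ i := fun h => hv (h ▸ hi)
  simpa [Finsupp.single_apply, hiv] using hmi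

lemma coeff_X_mul_eq_zero {m : V →₀ ℕ} {v : V} (hm : m v = 0) (p : MvPolynomial V k) :
    coeff m (X v * p) = 0 := by
  classical
  rw [coeff_X_mul', if_neg (by simpa using hm)]

lemma coeff_eq_zero_of_mem_pow {I : Ideal (MvPolynomial V k)}
    (hI : ∀ p ∈ I, p ∈ idealOfVars V k ^ 2) {s : ℕ} {p : MvPolynomial V k} (hp : p ∈ I ^ s)
    {m : V →₀ ℕ} (hm : m.degree < 2 * s) : coeff m p = 0 := by
  have h : I ^ s ≤ idealOfVars V k ^ (2 * s) := by
    rw [pow_mul]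
    exact Ideal.pow_right_mono hI s
  exact (mem_pow_idealOfVars_iff' _ _).1 (h hp) m hm

lemma pow_card_mul_prod_mem_pow {R : Type*} [CommRing R] {I : Ideal R} {ι : Type*}
    (T : Finset ι) (x : R) (y : ι → R) (h : ∀ i ∈ T, x * y i ∈ I) :
    x ^ T.card * ∏ i ∈ T, y i ∈ I ^ T.card := by
  rw [← Finset.prod_const, ← Finset.prod_const, ← Finset.prod_mul_distrib]
  exact Ideal.prod_mem_prod h

lemma pow_card_mul_prod_mul_mem_pow {R : Type*} [CommRing R] {I : Ideal R} {ι : Type*}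
    {T : Finset ι} {x b u w : R} {y : ι → R} (hy : ∀ i ∈ T, x * y i ∈ I) (hb : x * b ∈ I)
    (hw : x * w ∈ I) (hu : u * b ∈ I ∨ ∃ a ∈ T, u * y a ∈ I) :
    x ^ (T.card + 1) * b * (∏ i ∈ T, y i) * (u * w) ∈ I ^ (T.card + 2) := by
  classical
  rcases hu with hu | ⟨a, ha, hu⟩
  · have h := Ideal.mul_mem_mul (pow_card_mul_prod_mem_pow T x y hy)
      (Ideal.mul_mem_mul hw hu)
    rw [← pow_two, ← pow_add] at h
    convert h using 1
    ring
  · have h := Ideal.mul_mem_mul (pow_card_mul_prod_mem_pow (T.erase a) x y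
      fun i hi => hy i (Finset.mem_of_mem_erase hi)) (Ideal.mul_mem_mul hw (Ideal.mul_mem_mul hb hu))
    rw [← pow_two, ← pow_succ', ← pow_add] at h
    have hcard := Finset.card_erase_add_one ha
    rw [show (T.erase a).card + (2 + 1) = T.card + 2 by omega] at h
    refine (congrArg (· ∈ I ^ (T.card + 2)) ?_).mpr h
    rw [← Finset.mul_prod_erase T y ha, ← hcard]
    ring

/-- The endomorphism of the polynomial ring setting the variables indexed by `τ` to zero. -/
noncomputable abbrev killRight (k : Type) [Field k] (σ τ : Type) :
    MvPolynomial (σ ⊕ τ) k →ₐ[k] MvPolynomial (σ ⊕ τ) k :=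
  aeval (Sum.elim (fun i => X (Sum.inl i)) 0)

variable {σ τ : Type}

lemma killRight_sub_mem (p : MvPolynomial (σ ⊕ τ) k) :
    p - killRight k σ τ p ∈
      Ideal.span (X '' (Set.range Sum.inr) : Set (MvPolynomial (σ ⊕ τ) k)) := by
  rw [← Ideal.Quotient.eq]
  let K := Ideal.span (X '' (Set.range Sum.inr) : Set (MvPolynomial (σ ⊕ τ) k))
  have : Ideal.Quotient.mkₐ k K = (Ideal.Quotient.mkₐ k K).comp (killRight k σ τ) := by
    refine algHom_ext fun i => ?_
    cases i with
    | inl i => simp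
    | inr i =>
      have : (X (Sum.inr i) : MvPolynomial (σ ⊕ τ) k) ∈ K :=
        Ideal.subset_span ⟨_, ⟨i, rfl⟩, rfl⟩
      simpa using Ideal.Quotient.eq_zero_iff_mem.2 this
  exact DFunLike.congr_fun this p

lemma killRight_mem {s : Set σ} {p : MvPolynomial (σ ⊕ τ) k}
    (hp : p ∈ Ideal.span (X '' (Sum.inl '' s ∪ Set.range Sum.inr))) :
    killRight k σ τ p ∈ Ideal.span (X '' (Sum.inl '' s) : Set (MvPolynomial (σ ⊕ τ) k)) := by
  suffices h : Ideal.span (X '' (Sum.inl '' s ∪ Set.range Sum.inr)) ≤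
      (Ideal.span (X '' (Sum.inl '' s) : Set (MvPolynomial (σ ⊕ τ) k))).comap (killRight k σ τ) from
    h hp
  rw [Ideal.span_le]
  rintro _ ⟨_, ⟨i, hi, rfl⟩ | ⟨i, rfl⟩, rfl⟩
  · refine Ideal.mem_comap.2 ?_
    rw [aeval_X]
    exact Ideal.subset_span ⟨_, ⟨i, hi, rfl⟩, rfl⟩
  · refine Ideal.mem_comap.2 ?_
    rw [aeval_X]
    exact Ideal.zero_mem _

lemma exists_linearMap_killRight {s : Set σ} {f : MvPolynomial (σ ⊕ τ) k}
    {L : Ideal (MvPolynomial (σ ⊕ τ) k)}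
    (hf : ∀ i ∈ s, ∀ l, f * (X (Sum.inl i) * X (Sum.inr l)) ∈ L) :
    ∃ φ : Ideal.span (X '' (Sum.inl '' s ∪ Set.range Sum.inr) : Set (MvPolynomial (σ ⊕ τ) k))
        →ₗ[MvPolynomial (σ ⊕ τ) k] MvPolynomial (σ ⊕ τ) k ⧸ L,
      ∀ c, φ c = Submodule.Quotient.mk (f * killRight k σ τ c) := by
  have key : Ideal.span (X '' (Sum.inl '' s) : Set (MvPolynomial (σ ⊕ τ) k)) *
      Ideal.span (X '' (Set.range Sum.inr)) ≤ Submodule.comap (LinearMap.mulLeft _ f) L := by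
    rw [Ideal.span_mul_span', Ideal.span_le]
    rintro _ ⟨_, ⟨_, ⟨i, hi, rfl⟩, rfl⟩, _, ⟨_, ⟨l, rfl⟩, rfl⟩, rfl⟩
    exact hf i hi l
  refine ⟨{ toFun := fun c => Submodule.Quotient.mk (f * killRight k σ τ c)
            map_add' := fun a b => ?_
            map_smul' := fun a b => ?_ }, fun _ => rfl⟩
  · rw [Submodule.coe_add, map_add, mul_add, Submodule.Quotient.mk_add]
  · rw [RingHom.id_apply, ← Submodule.Quotient.mk_smul, eq_comm, Submodule.Quotient.eq]
    have h := key (Ideal.mul_mem_mul (killRight_mem b.2) (killRight_sub_mem a))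
    convert (show f * _ ∈ L from h) using 1
    rw [Submodule.coe_smul, smul_eq_mul, smul_eq_mul, map_mul]
    ring

/-- The obstruction to multiplication by a single element `W`. -/
lemma false_of_sub_mem {i : σ} {l : τ} {e : (σ ⊕ τ) →₀ ℕ} {f W : MvPolynomial (σ ⊕ τ) k}
    (hf : f = monomial e 1) {I : Ideal (MvPolynomial (σ ⊕ τ) k)}
    (hI : ∀ p ∈ I, p ∈ idealOfVars (σ ⊕ τ) k ^ 2) {s n : ℕ} (he : e.degree + 1 < 2 * s)
    {x : ℕ → MvPolynomial (σ ⊕ τ) k}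
    (hx : ∀ r < n, ∃ a, a ≠ i ∧ e (Sum.inl a) = 0 ∧ x r = X (Sum.inl a))
    (hi : ∃ v : ℕ → MvPolynomial (σ ⊕ τ) k, f * X (Sum.inl i) - X (Sum.inl i) * W -
      ∑ r ∈ Finset.range n, x r * v r ∈ I ^ s)
    (hl : ∃ v : ℕ → MvPolynomial (σ ⊕ τ) k, - (X (Sum.inr l) * W) -
      ∑ r ∈ Finset.range n, x r * v r ∈ I ^ s) : False := by
  classical
  have hsum (u : σ ⊕ τ) (hu : ∀ a, a ≠ i → u ≠ Sum.inl a)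
      (v : ℕ → MvPolynomial (σ ⊕ τ) k) :
      coeff (Finsupp.single u 1 + e) (∑ r ∈ Finset.range n, x r * v r) = 0 := by
    rw [coeff_sum]
    refine Finset.sum_eq_zero fun r hr => ?_
    obtain ⟨a, hai, hea, hxa⟩ := hx r (Finset.mem_range.1 hr)
    rw [hxa]
    refine coeff_X_mul_eq_zero ?_ _
    simp [hu a hai, hea]
  have hdeg (u : σ ⊕ τ) : (Finsupp.single u 1 + e).degree < 2 * s := by
    rw [map_add, Finsupp.degree_single]
    omega
  obtain ⟨v, hv⟩ := hi
  obtain ⟨v', hv'⟩ := hl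
  have h1 := coeff_eq_zero_of_mem_pow hI hv (hdeg (Sum.inl i))
  have h2 := coeff_eq_zero_of_mem_pow hI hv' (hdeg (Sum.inr l))
  rw [coeff_sub, hsum _ (by simp)] at h2
  rw [coeff_sub, coeff_sub, hsum _ (by
    intro a ha h
    exact ha (Sum.inl_injective h).symm), mul_comm f, coeff_X_mul, coeff_X_mul, hf,
    coeff_monomial, if_pos rfl] at h1
  rw [coeff_neg, coeff_X_mul] at h2
  have h3 : coeff e W = 0 := by simpa using h2
  rw [h3] at h1
  simp at h1

end Polynomial

section TailVariables

/-- The variables `x_c, x_{c+1}, …, x_{d-1}`, followed by ones. -/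
noncomputable abbrev tailVar (k : Type) [Field k] (d c r : ℕ) : MvPolynomial (Fin d ⊕ Fin d) k :=
  if h : c + r < d then X (Sum.inl ⟨c + r, h⟩) else 1

variable {k : Type} [Field k] {d c : ℕ}

lemma initialIdeal_tailVar {r : ℕ} (hr : c + r ≤ d) :
    initialIdeal (tailVar k d c) r =
      Ideal.span (X '' (Sum.inl '' {i : Fin d | c ≤ i ∧ i < c + r})) := by
  rw [initialIdeal, Set.image_image]
  congr 1
  ext p
  constructor
  · rintro ⟨i, hi, rfl⟩
    have hi' : i < r := hi
    exact ⟨⟨c + i, by omega⟩, ⟨by simp, by simpa using hi'⟩, by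
      rw [tailVar, dif_pos (by omega : c + i < d)]⟩
  · rintro ⟨i, ⟨hi, hi'⟩, rfl⟩
    refine ⟨i - c, by simp only [Set.mem_Iio]; omega, ?_⟩
    have h : c + (i - c) = (i : ℕ) := by omega
    simp [tailVar, h]

lemma mem_of_tailVar_mul_mem {s : Set (Fin d ⊕ Fin d)}
    (hs : ∀ i : Fin d, c ≤ i → Sum.inl i ∉ s) (r : ℕ) (p : MvPolynomial (Fin d ⊕ Fin d) k)
    (hp : tailVar k d c r * p ∈ initialIdeal (tailVar k d c) r ⊔ Ideal.span (X '' s)) :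
    p ∈ initialIdeal (tailVar k d c) r ⊔ Ideal.span (X '' s) := by
  by_cases h : c + r < d
  · rw [initialIdeal_tailVar h.le, ← Ideal.span_union, ← Set.image_union] at hp ⊢
    rw [tailVar, dif_pos h] at hp
    refine mem_span_X_image_of_X_mul_mem ?_ hp
    rintro (⟨i, ⟨-, hi⟩, hir⟩ | hr)
    · rw [Sum.inl_injective hir] at hi
      exact lt_irrefl _ hi
    · exact hs _ (by simp) hr
  · rwa [tailVar, dif_neg h, one_mul] at hp

lemma initialIdeal_tailVar_sup (hc : c ≤ d) :
    initialIdeal (tailVar k d c) (d - c) ⊔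
      Ideal.span (X '' (Sum.inl '' {i : Fin d | (i : ℕ) < c} ∪ Set.range Sum.inr)) =
    maxHomIdeal k (Fin d ⊕ Fin d) := by
  rw [initialIdeal_tailVar (by omega), ← Ideal.span_union, ← Set.image_union, maxHomIdeal]
  refine congrArg Ideal.span (Eq.trans (congrArg _ ?_) Set.image_univ)
  rw [Set.eq_univ_iff_forall]
  rintro (i | i)
  · by_cases hi : (i : ℕ) < c
    · exact Or.inr (Or.inl ⟨i, hi, rfl⟩)
    · exact Or.inl ⟨i, ⟨by omega, by omega⟩, rfl⟩
  · exact Or.inr (Or.inr ⟨i, rfl⟩)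

/-- A criterion for nonvanishing of `Ext` from the residue field into `S ⧸ I ^ s`, in terms of a
monomial which carries `(x_0, …, x_{c-1}) (y_0, …, y_{d-1})` into `I ^ s`. -/
lemma exists_ext_ne_zero {e : (Fin d ⊕ Fin d) →₀ ℕ} {I : Ideal (MvPolynomial (Fin d ⊕ Fin d) k)}
    (hI : ∀ p ∈ I, p ∈ idealOfVars (Fin d ⊕ Fin d) k ^ 2) {s : ℕ} (he : e.degree + 1 < 2 * s)
    (hc0 : 0 < c) (hcd : c ≤ d) (hec : ∀ i : Fin d, c ≤ i → e (Sum.inl i) = 0)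
    (hf : ∀ i : Fin d, (i : ℕ) < c → ∀ l : Fin d,
      monomial e 1 * (X (Sum.inl i) * X (Sum.inr l)) ∈ I ^ s) :
    ∃ α : CategoryTheory.Abelian.Ext
      (ModuleCat.of (MvPolynomial (Fin d ⊕ Fin d) k) (MvPolynomial (Fin d ⊕ Fin d) k ⧸ maxHomIdeal k (Fin d ⊕ Fin d)))
      (ModuleCat.of (MvPolynomial (Fin d ⊕ Fin d) k) (MvPolynomial (Fin d ⊕ Fin d) k ⧸ I ^ s)) (d - c + 1), α ≠ 0 := by
  by_contra! hM
  obtain ⟨φ, hφ⟩ := exists_linearMap_killRight (s := {i : Fin d | (i : ℕ) < c}) hf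
  have h0 (r : ℕ) (p : MvPolynomial (Fin d ⊕ Fin d) k)
      (hp : tailVar k d c r * p ∈ initialIdeal (tailVar k d c) r) :
      p ∈ initialIdeal (tailVar k d c) r := by
    have h := mem_of_tailVar_mul_mem (k := k) (d := d) (c := c) (s := ∅) (by simp) r p
    simpa using h (by simpa using hp)
  obtain ⟨w, hw⟩ := exists_forall_sub_smul_eq_sum h0
    (mem_of_tailVar_mul_mem (by
      rintro i hi (⟨i', hi', h⟩ | ⟨i', h⟩)
      · rw [Sum.inl_injective h] at hi'
        exact absurd hi' (not_lt.2 hi)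
      · cases h)) (initialIdeal_tailVar_sup hcd) hM φ
  obtain ⟨W, rfl⟩ := Submodule.Quotient.mk_surjective _ w
  have lift (p : MvPolynomial (Fin d ⊕ Fin d) k)
      (hp : p ∈ Ideal.span (X '' (Sum.inl '' {i : Fin d | (i : ℕ) < c} ∪ Set.range Sum.inr))) :
      ∃ v : ℕ → MvPolynomial (Fin d ⊕ Fin d) k,
        monomial e 1 * killRight k (Fin d) (Fin d) p - p * W -
          ∑ r ∈ Finset.range (d - c), tailVar k d c r * v r ∈ I ^ s := by
    obtain ⟨v, hv⟩ := hw ⟨p, hp⟩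
    choose v' hv' using fun r => Submodule.Quotient.mk_surjective _ (v r)
    refine ⟨v', (Submodule.Quotient.mk_eq_zero _).1 ?_⟩
    rw [hφ] at hv
    rw [Submodule.Quotient.mk_sub, Submodule.Quotient.mk_sub, ← smul_eq_mul p,
      Submodule.Quotient.mk_smul, hv, sub_eq_zero, ← Submodule.mkQ_apply, map_sum]
    refine Finset.sum_congr rfl fun r _ => ?_
    rw [← hv', Submodule.mkQ_apply, ← smul_eq_mul, Submodule.Quotient.mk_smul]
  have hd : 0 < d := hc0.trans_le hcd
  refine false_of_sub_mem (i := ⟨0, hd⟩) (l := ⟨0, hd⟩) (W := W) rfl hI he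
    (n := d - c) (x := tailVar k d c) ?_ ?_ ?_
  · intro r hr
    have h : c + r < d := by omega
    refine ⟨⟨c + r, h⟩, ?_, hec _ (by simp), by rw [tailVar, dif_pos h]⟩
    rw [Ne, Fin.mk.injEq]
    omega
  · simpa using lift (X (Sum.inl ⟨0, hd⟩)) (Ideal.subset_span ⟨_, Or.inl ⟨_, hc0, rfl⟩, rfl⟩)
  · simpa using lift (X (Sum.inr ⟨0, hd⟩)) (Ideal.subset_span ⟨_, Or.inr ⟨_, rfl⟩, rfl⟩)

end TailVariables

/-- Upper bound for depth of powers of the edge ideal of the Cohen-Macaulay bipartite graph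
`G_{d,j}` of Banerjee-Mukundan, whose edge ideal is
`I(G_{d,j}) = (x_i y_i, x_1 y_i, x_k y_j : 1 ≤ i ≤ d, 1 ≤ k ≤ j)` (here `x_i = X (inl i)`,
`y_i = X (inr i)`, with `1`-based indices translated to `0`-based `Fin d` indices):
`depth S/I(G_{d,j})^s ≤ d - j - s + 3` for every `2 ≤ s ≤ d - j - 2`. -/
theorem depth_power_BM_graph_upper_bound (k : Type) [Field k] (d j : ℕ)
    (hj1 : 1 ≤ j) (hjd : j ≤ d)
    (I : Ideal (MvPolynomial (Fin d ⊕ Fin d) k))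
    (hI : I = Ideal.span
      ({p | ∃ i : Fin d, p = X (Sum.inl i) * X (Sum.inr i)} ∪
       {p | ∃ i : Fin d, p = X (Sum.inl (⟨0, by omega⟩ : Fin d)) * X (Sum.inr i)} ∪
       {p | ∃ km : Fin d, (km : ℕ) < j ∧
          p = X (Sum.inl km) * X (Sum.inr (⟨j - 1, by omega⟩ : Fin d))})) :
    ∀ s : ℕ, 2 ≤ s → (s : ℤ) ≤ (d : ℤ) - j - 2 →
      (depthQuot k (I ^ s) : ℤ) ≤ (d : ℤ) - j - s + 3 := by
  intro s hs hsd
  obtain ⟨t, rfl⟩ := Nat.exists_eq_add_of_le' hs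
  have hd : j + t < d := by omega
  let T : Finset (Fin d) := Finset.Ico ⟨j, by omega⟩ ⟨j + t, hd⟩
  have hT : T.card = t := by simp [T, Fin.card_Ico]
  let e : (Fin d ⊕ Fin d) →₀ ℕ := Finsupp.single (Sum.inl ⟨0, by omega⟩) (t + 1) +
    Finsupp.single (Sum.inr ⟨j - 1, by omega⟩) 1 + ∑ i ∈ T, Finsupp.single (Sum.inr i) 1
  have hdiag (i : Fin d) : X (Sum.inl i) * X (Sum.inr i) ∈ I :=
    hI ▸ Ideal.subset_span (Or.inl (Or.inl ⟨i, rfl⟩))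
  have hrow (i : Fin d) : X (Sum.inl ⟨0, by omega⟩) * X (Sum.inr i) ∈ I :=
    hI ▸ Ideal.subset_span (Or.inl (Or.inr ⟨i, rfl⟩))
  have hcol (i : Fin d) (hi : (i : ℕ) < j) :
      X (Sum.inl i) * X (Sum.inr ⟨j - 1, by omega⟩) ∈ I :=
    hI ▸ Ideal.subset_span (Or.inr ⟨i, hi, rfl⟩)
  have hX (u v : Fin d ⊕ Fin d) :
      (X u * X v : MvPolynomial (Fin d ⊕ Fin d) k) ∈ idealOfVars (Fin d ⊕ Fin d) k ^ 2 := by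
    rw [pow_two]
    exact Ideal.mul_mem_mul (Ideal.subset_span ⟨u, rfl⟩) (Ideal.subset_span ⟨v, rfl⟩)
  have hI2 : I ≤ idealOfVars (Fin d ⊕ Fin d) k ^ 2 := by
    rw [hI, Ideal.span_le]
    rintro _ ((⟨i, rfl⟩ | ⟨i, rfl⟩) | ⟨i, -, rfl⟩) <;> exact hX _ _
  have hf : (monomial e 1 : MvPolynomial (Fin d ⊕ Fin d) k) =
      X (Sum.inl ⟨0, by omega⟩) ^ (T.card + 1) * X (Sum.inr ⟨j - 1, by omega⟩) *
        ∏ i ∈ T, X (Sum.inr i) := by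
    rw [hT, X_pow_eq_monomial, X, monomial_mul, one_mul]
    simp only [X]
    rw [← monomial_sum_one, monomial_mul, one_mul]
  obtain ⟨α, hα⟩ := exists_ext_ne_zero (c := j + t) (s := t + 2) (e := e) hI2
    (by simp [e, map_sum, hT]; omega) (by omega) hd.le
    (by
      intro i hi
      have : (0 : ℕ) ≠ i := by omega
      simp [e, Fin.ext_iff, this])
    (by
      intro i hi l
      have h := pow_card_mul_prod_mul_mem_pow (T := T) (y := fun i => X (Sum.inr i))
        (fun i _ => hrow i) (hrow ⟨j - 1, by omega⟩) (hrow l) (u := X (Sum.inl i)) (by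
          by_cases hij : (i : ℕ) < j
          · exact Or.inl (hcol i hij)
          · exact Or.inr ⟨i, Finset.mem_Ico.2 ⟨not_lt.1 hij, hi⟩, hdiag i⟩)
      rwa [← hf, hT] at h)
  obtain ⟨i, hi, hi'⟩ := exists_nontrivial_localCohomology_le α hα
  have h : depthQuot k (I ^ (t + 2)) ≤ i := Nat.sInf_le hi'
  omega
end
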